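/- arXiv:1110.6600 — 2 statements merged into one kernel-verified Lean document; each statement's English description precedes it below -/
import Mathlib

section
/- For every λ ∈ (0,1) there exists a constant c ≥ 1, depending only on λ, such that for every origin O ∈ ℝ², every finite CNN request sequence ρ = r(p_1),…,r(p_n), and every run s_0 = O, s_1, …, s_n of the generalized work function algorithm WFA_λ on ρ, the total distance traveled satisfies Σ_{i=1}^n d(s_{i−1}, s_i) ≤ c · Opt_ρ. In other words, WFA_λ is constant competitive for the CNN problem. -/
noncomputable section

/-- The L1 metric on `ℝ²` (the CNN metric space). -/
def dL1 (p q : ℝ × ℝ) : ℝ := |p.1 - q.1| + |p.2 - q.2|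

/-- The CNN request associated with a point `(x, y)`: all points sharing a coordinate with it. -/
def req (p : ℝ × ℝ) : Set (ℝ × ℝ) := {q | q.1 = p.1 ∨ q.2 = p.2}

/-- The work function of a finite CNN request sequence (requests listed in order of arrival),
starting at origin `O`: the infimum over choices `tᵢ ∈ r(pᵢ)` of the length of the path
`O, t₁, …, tₙ, s`. -/
noncomputable def WF (O : ℝ × ℝ) : List (ℝ × ℝ) → (ℝ × ℝ) → ℝ
  | [], s => dL1 O s
  | p :: l, s => sInf ((fun t => dL1 O t + WF t l s) '' req p)

/-- The optimal (offline) cost of serving the request sequence `σ` from origin `O`. -/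
noncomputable def OptC (O : ℝ × ℝ) (σ : List (ℝ × ℝ)) : ℝ := sInf (Set.range (WF O σ))

/-- `s 0 = O, s 1, …, s n` is a run of the generalized work function algorithm `WFA_λ` on `σ`:
each `s (i+1)` attains the minimum over `t` of `W_{r₁…r_{i+1}}(t) + λ·d(s i, t)`. -/
def IsWFARun (lam : ℝ) (O : ℝ × ℝ) (σ : List (ℝ × ℝ)) (s : ℕ → ℝ × ℝ) : Prop :=
  s 0 = O ∧ ∀ i < σ.length, ∀ t : ℝ × ℝ,
    WF O (σ.take (i + 1)) (s (i + 1)) + lam * dL1 (s i) (s (i + 1)) ≤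
      WF O (σ.take (i + 1)) t + lam * dL1 (s i) t

/-! ### The metric -/

lemma d_nonneg (a b : ℝ × ℝ) : 0 ≤ dL1 a b := by unfold dL1; positivity
lemma d_comm (a b : ℝ × ℝ) : dL1 a b = dL1 b a := by
  unfold dL1; rw [abs_sub_comm a.1, abs_sub_comm a.2]
lemma d_self (a : ℝ × ℝ) : dL1 a a = 0 := by simp [dL1]
lemma d_tri (a b c : ℝ × ℝ) : dL1 a c ≤ dL1 a b + dL1 b c := by
  unfold dL1
  linarith [abs_sub_le a.1 b.1 c.1, abs_sub_le a.2 b.2 c.2]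
lemma d_fst (a b : ℝ × ℝ) : |a.1 - b.1| ≤ dL1 a b := by
  unfold dL1; linarith [abs_nonneg (a.2 - b.2)]
lemma d_snd (a b : ℝ × ℝ) : |a.2 - b.2| ≤ dL1 a b := by
  unfold dL1; linarith [abs_nonneg (a.1 - b.1)]
lemma d_eq_zero {a b : ℝ × ℝ} (h : dL1 a b ≤ 0) : a = b := by
  have h1 := (d_fst a b).trans h
  have h2 := (d_snd a b).trans h
  have e1 := abs_nonpos_iff.1 h1
  have e2 := abs_nonpos_iff.1 h2
  exact Prod.ext (by linarith) (by linarith)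
lemma d_swap (a b : ℝ × ℝ) : dL1 a.swap b.swap = dL1 a b := by
  simp [dL1, add_comm]

/-! ### Work functions -/

lemma WF_nonneg (l : List (ℝ × ℝ)) : ∀ O s, 0 ≤ WF O l s := by
  induction l with
  | nil => intro O s; exact d_nonneg _ _
  | cons p l ih =>
    intro O s
    simp only [WF]
    apply Real.sInf_nonneg
    rintro _ ⟨t, _, rfl⟩
    exact add_nonneg (d_nonneg _ _) (ih t s)

lemma WF_cons_le (p : ℝ × ℝ) (l : List (ℝ × ℝ)) (O s t : ℝ × ℝ) (ht : t ∈ req p) :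
    WF O (p :: l) s ≤ dL1 O t + WF t l s := by
  simp only [WF]
  refine csInf_le ⟨0, ?_⟩ ⟨t, ht, rfl⟩
  rintro _ ⟨t, _, rfl⟩
  exact add_nonneg (d_nonneg _ _) (WF_nonneg l t s)

lemma req_self (p : ℝ × ℝ) : p ∈ req p := Or.inl rfl

lemma WF_lip_left (l : List (ℝ × ℝ)) (O O' s : ℝ × ℝ) : WF O l s ≤ dL1 O O' + WF O' l s := by
  cases l with
  | nil => exact d_tri _ _ _
  | cons p l =>
    have : WF O (p :: l) s - dL1 O O' ≤ WF O' (p :: l) s := by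
      conv_rhs => simp only [WF]
      apply le_csInf
      · exact ⟨_, p, req_self p, rfl⟩
      · rintro _ ⟨t, ht, rfl⟩
        have h1 := WF_cons_le p l O s t ht
        have h2 := d_tri O O' t
        simp only
        linarith
    linarith

lemma req_closed (p : ℝ × ℝ) : IsClosed (req p) := by
  have : req p = {q : ℝ × ℝ | q.1 = p.1} ∪ {q : ℝ × ℝ | q.2 = p.2} := rfl
  rw [this]
  exact (isClosed_eq continuous_fst continuous_const).union
    (isClosed_eq continuous_snd continuous_const)

lemma d_cont (O : ℝ × ℝ) : Continuous (fun t => dL1 O t) := by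
  unfold dL1; fun_prop

lemma WF_cont (l : List (ℝ × ℝ)) (s : ℝ × ℝ) : Continuous (fun t => WF t l s) := by
  have hl : LipschitzWith 2 (fun t => WF t l s) := by
    apply LipschitzWith.of_le_add_mul
    intro a b
    have h := WF_lip_left l a b s
    have h1 : |a.1 - b.1| ≤ dist a b := by
      rw [Prod.dist_eq]; exact le_max_left _ _
    have h2 : |a.2 - b.2| ≤ dist a b := by
      rw [Prod.dist_eq]; exact le_max_right _ _
    have : dL1 a b ≤ 2 * dist a b := by unfold dL1; linarith
    push_cast
    linarith
  exact hl.continuous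

lemma WF_cons_att (p : ℝ × ℝ) (l : List (ℝ × ℝ)) (O s : ℝ × ℝ) :
    ∃ t ∈ req p, WF O (p :: l) s = dL1 O t + WF t l s := by
  set f : ℝ × ℝ → ℝ := fun t => dL1 O t + WF t l s with hf
  have hc : Continuous f := (d_cont O).add (WF_cont l s)
  have hk : IsCompact (req p ∩ Metric.closedBall O (f p)) :=
    (isCompact_closedBall O (f p)).inter_left (req_closed p)
  have key : ∀ t, f t ≤ f p → t ∈ Metric.closedBall O (f p) := by
    intro t ht
    rw [Metric.mem_closedBall, Prod.dist_eq]
    have h0 := WF_nonneg l t s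
    have h1 := d_fst t O
    have h2 := d_snd t O
    have h3 := d_comm t O
    have h4 : dL1 O t ≤ f p := by simp only [hf] at ht ⊢; linarith
    apply max_le
    · change |t.1 - O.1| ≤ _; linarith
    · change |t.2 - O.2| ≤ _; linarith
  obtain ⟨t, ht, hmin⟩ := hk.exists_isMinOn ⟨p, req_self p, key p le_rfl⟩ hc.continuousOn
  refine ⟨t, ht.1, le_antisymm (WF_cons_le p l O s t ht.1) ?_⟩
  simp only [WF]
  apply le_csInf
  · exact ⟨_, p, req_self p, rfl⟩
  · rintro _ ⟨u, hu, rfl⟩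
    have hp : f t ≤ f p := hmin ⟨req_self p, key p le_rfl⟩
    by_cases h : f u ≤ f p
    · exact hmin ⟨hu, key u h⟩
    · change f t ≤ f u
      linarith

lemma WF_lip (l : List (ℝ × ℝ)) : ∀ O a b, WF O l a ≤ WF O l b + dL1 a b := by
  induction l with
  | nil =>
    intro O a b
    simp only [WF]
    linarith [d_tri O b a, d_comm a b]
  | cons p l ih =>
    intro O a b
    obtain ⟨t, ht, h⟩ := WF_cons_att p l O b
    have := WF_cons_le p l O a t ht
    linarith [ih t a b]

lemma WF_ge (l : List (ℝ × ℝ)) : ∀ O s, dL1 O s ≤ WF O l s := by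
  induction l with
  | nil => intro O s; exact le_rfl
  | cons p l ih =>
    intro O s
    obtain ⟨t, ht, h⟩ := WF_cons_att p l O s
    linarith [ih t s, d_tri O t s]

lemma WF_snoc_le (r : ℝ × ℝ) (l : List (ℝ × ℝ)) : ∀ O s, ∀ t ∈ req r,
    WF O (l ++ [r]) s ≤ WF O l t + dL1 t s := by
  induction l with
  | nil => intro O s t ht; exact WF_cons_le r [] O s t ht
  | cons p l ih =>
    intro O s t ht
    obtain ⟨u, hu, h⟩ := WF_cons_att p l O t
    have h1 := WF_cons_le p (l ++ [r]) O s u hu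
    have h2 := ih u s t ht
    rw [List.cons_append]
    linarith

lemma WF_snoc_att (r : ℝ × ℝ) (l : List (ℝ × ℝ)) : ∀ O s, ∃ t ∈ req r,
    WF O (l ++ [r]) s = WF O l t + dL1 t s := by
  induction l with
  | nil => intro O s; exact WF_cons_att r [] O s
  | cons p l ih =>
    intro O s
    obtain ⟨u, hu, h⟩ := WF_cons_att p (l ++ [r]) O s
    obtain ⟨t, ht, h'⟩ := ih u s
    refine ⟨t, ht, le_antisymm (WF_snoc_le r (p :: l) O s t ht) ?_⟩
    have := WF_cons_le p l O t u hu
    rw [List.cons_append]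
    linarith


/-! ### The potential -/

/-- Parameters of the potential function. -/
structure Par where
  g : ℝ
  C : ℝ
  k : ℝ
  N : ℕ
  θ : Fin N → ℝ
  hg : 0 < g
  hg2 : g < 1 / 2
  hk : k * g = 1
  hN : 1 ≤ N
  hC : C * g = 4 * N + 100 * k
  hθ : ∀ j, |θ j| ≤ 1
  grid : ∀ c : ℝ, |c| ≤ 1 → ∃ j, |θ j - c| ≤ g / 2

/-- The slack parameter `λ = 1 - 2γ`. -/
def Par.l (P : Par) : ℝ := 1 - 2 * P.g
def Par.c1 (P : Par) : ℝ := P.C * P.g - 2 * P.N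
def Par.K3 (P : Par) : ℝ := 64 * P.k
def Par.κ0 (P : Par) : ℝ := P.g ^ 2 / 1024

lemma Par.k2 (P : Par) : 2 ≤ P.k := by
  have := P.hk; have := P.hg; have := P.hg2
  have hk : 0 < P.k := by
    by_contra h; push Not at h; nlinarith
  nlinarith
lemma Par.c1_eq (P : Par) : P.c1 = 2 * P.N + 100 * P.k := by
  unfold Par.c1; rw [P.hC]; ring
lemma Par.c1_ge (P : Par) : 100 * P.k + 2 ≤ P.c1 := by
  rw [P.c1_eq]; have : (1:ℝ) ≤ P.N := by exact_mod_cast P.hN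
  linarith
lemma Par.C_pos (P : Par) : 0 < P.C := by
  have h := P.hC; have hg := P.hg; have := P.k2
  have : (0:ℝ) ≤ P.N := by positivity
  by_contra hh; push Not at hh; nlinarith
lemma Par.C_ge (P : Par) : 200 * P.k ≤ P.C := by
  have h := P.hC; have hg := P.hg; have := P.k2; have := P.hg2; have := P.C_pos
  have : (0:ℝ) ≤ P.N := by positivity
  nlinarith
lemma Par.Cg_le (P : Par) : P.C * P.g ≤ 2 * P.c1 := by
  rw [P.hC, P.c1_eq]; have := P.k2; linarith

def Hf (θ : ℝ) (s s1 s2 : ℝ × ℝ) : ℝ := min (dL1 s s1 - θ * dL1 s1 s2) (dL1 s s2)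

lemma Hf_lip {θ : ℝ} (h : |θ| ≤ 1) (s s1 s2 s' s1' s2' : ℝ × ℝ) :
    Hf θ s s1 s2 ≤ Hf θ s' s1' s2' + dL1 s s' + 2 * (dL1 s1 s1' + dL1 s2 s2') := by
  have e1 := d_tri s s' s1
  have e2 := d_tri s' s1' s1
  have e3 := d_tri s s' s2
  have e4 := d_tri s' s2' s2
  have e5 := d_tri s1 s1' s2
  have e6 := d_tri s1' s2' s2
  have e7 := d_tri s1' s1 s2'
  have e8 := d_tri s1 s2 s2'
  rw [d_comm s1' s1] at e2 e7
  rw [d_comm s2' s2] at e4 e6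
  have n1 := d_nonneg s1 s1'
  have n2 := d_nonneg s2 s2'
  have key : θ * (dL1 s1' s2' - dL1 s1 s2) ≤ dL1 s1 s1' + dL1 s2 s2' := by
    have hb : |dL1 s1' s2' - dL1 s1 s2| ≤ dL1 s1 s1' + dL1 s2 s2' := by
      rw [abs_le]; constructor <;> linarith
    calc θ * (dL1 s1' s2' - dL1 s1 s2) ≤ |θ * (dL1 s1' s2' - dL1 s1 s2)| := le_abs_self _
      _ = |θ| * |dL1 s1' s2' - dL1 s1 s2| := abs_mul _ _
      _ ≤ 1 * (dL1 s1 s1' + dL1 s2 s2') := by gcongr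
      _ = _ := one_mul _
  unfold Hf
  rw [add_assoc, ← min_add_add_right]
  refine le_min ?_ ?_
  · refine (min_le_left _ _).trans ?_
    linarith
  · refine (min_le_right _ _).trans ?_
    linarith

def F0 (P : Par) (w : ℝ × ℝ → ℝ) (s1 s2 : ℝ × ℝ) (σ : Fin P.N → ℝ × ℝ) : ℝ :=
  P.C * (w s1 + w s2 - (1 - P.g) * dL1 s1 s2) +
    ∑ j, (w (σ j) - (1 - P.g) * Hf (P.θ j) (σ j) s1 s2)

lemma F0_move (P : Par) (w1 w2 : ℝ × ℝ → ℝ) (s1 s2 s1' s2' : ℝ × ℝ) (σ σ' : Fin P.N → ℝ × ℝ) :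
    F0 P w2 s1' s2' σ' ≤ F0 P w1 s1 s2 σ
      + P.C * (w2 s1' + w2 s2' - w1 s1 - w1 s2 - (1 - P.g) * (dL1 s1' s2' - dL1 s1 s2))
      + 2 * P.N * (dL1 s1 s1' + dL1 s2 s2')
      + ∑ j, (w2 (σ' j) - w1 (σ j) + (1 - P.g) * dL1 (σ j) (σ' j)) := by
  have hsum : ∑ j, (w2 (σ' j) - (1 - P.g) * Hf (P.θ j) (σ' j) s1' s2') ≤
      ∑ j, ((w1 (σ j) - (1 - P.g) * Hf (P.θ j) (σ j) s1 s2) +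
        (w2 (σ' j) - w1 (σ j) + (1 - P.g) * dL1 (σ j) (σ' j)) +
        2 * (dL1 s1 s1' + dL1 s2 s2')) := by
    refine Finset.sum_le_sum fun j _ => ?_
    have h := Hf_lip (P.hθ j) (σ j) s1 s2 (σ' j) s1' s2'
    have hg := P.hg
    have hg2 := P.hg2
    have n1 := d_nonneg s1 s1'
    have n2 := d_nonneg s2 s2'
    have h2 := mul_le_mul_of_nonneg_left h (by linarith : 0 ≤ 1 - P.g)
    nlinarith
  rw [Finset.sum_add_distrib, Finset.sum_add_distrib] at hsum
  simp only [Finset.sum_const, Finset.card_univ, Fintype.card_fin, nsmul_eq_mul] at hsum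
  unfold F0
  linarith

lemma F0_proj (P : Par) (w1 w2 : ℝ × ℝ → ℝ) (s1 s2 s1' s2' : ℝ × ℝ) (σ σ' : Fin P.N → ℝ × ℝ)
    (h1 : w2 s1' ≤ w1 s1 - dL1 s1 s1') (h2 : w2 s2' ≤ w1 s2 - dL1 s2 s2')
    (h3 : ∀ j, w2 (σ' j) ≤ w1 (σ j) - dL1 (σ j) (σ' j)) :
    F0 P w2 s1' s2' σ' ≤ F0 P w1 s1 s2 σ - P.c1 * (dL1 s1 s1' + dL1 s2 s2')
      - P.g * ∑ j, dL1 (σ j) (σ' j) := by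
  have h := F0_move P w1 w2 s1 s2 s1' s2' σ σ'
  have hs : ∑ j, (w2 (σ' j) - w1 (σ j) + (1 - P.g) * dL1 (σ j) (σ' j)) ≤
      ∑ j, (- P.g * dL1 (σ j) (σ' j)) := by
    refine Finset.sum_le_sum fun j _ => ?_
    have := h3 j
    linarith
  rw [← Finset.mul_sum] at hs
  have e7 := d_tri s1 s1' s2
  have e6 := d_tri s1' s2' s2
  rw [d_comm s2' s2] at e6
  have hg2 := P.hg2
  have hh : (1 - P.g) * (dL1 s1 s2 - dL1 s1' s2') ≤ (1 - P.g) * (dL1 s1 s1' + dL1 s2 s2') :=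
    mul_le_mul_of_nonneg_left (by linarith) (by linarith)
  have hc : w2 s1' + w2 s2' - w1 s1 - w1 s2 - (1 - P.g) * (dL1 s1' s2' - dL1 s1 s2) ≤
      - P.g * (dL1 s1 s1' + dL1 s2 s2') := by linarith
  have := mul_le_mul_of_nonneg_left hc P.C_pos.le
  unfold Par.c1
  linarith

lemma F0_mono (P : Par) (w1 w2 : ℝ × ℝ → ℝ) (s1 s2 : ℝ × ℝ) (σ : Fin P.N → ℝ × ℝ)
    (h : ∀ s, w2 s ≤ w1 s) : F0 P w2 s1 s2 σ ≤ F0 P w1 s1 s2 σ := by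
  have := F0_proj P w1 w2 s1 s2 s1 s2 σ σ (by simpa [d_self] using h _) (by simpa [d_self] using h _)
    (fun j => by simpa [d_self] using h _)
  simpa [d_self] using this

lemma rep1 (P : Par) (w : ℝ × ℝ → ℝ) (s1 s2 u : ℝ × ℝ) (σ : Fin P.N → ℝ × ℝ) (a b : ℝ)
    (hb : 0 ≤ b) (h1 : w u ≤ w s1 + P.l * dL1 u s1 - a)
    (h2 : dL1 s1 s2 + dL1 u s1 - b ≤ dL1 u s2) :
    F0 P w u s2 σ ≤ F0 P w s1 s2 σ - P.C * (a - b) - P.c1 * dL1 u s1 := by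
  have h := F0_move P w w s1 s2 u s2 σ σ
  simp only [d_self, sub_self, mul_zero, add_zero, Finset.sum_const_zero] at h
  have hg2 := P.hg2
  have hg := P.hg
  unfold Par.l at h1
  have h3 := mul_le_mul_of_nonneg_left h2 (by linarith : 0 ≤ 1 - P.g)
  have h4 : 0 ≤ P.g * b := by positivity
  have hc : w u + w s2 - w s1 - w s2 - (1 - P.g) * (dL1 u s2 - dL1 s1 s2) ≤
      - P.g * dL1 u s1 - (a - b) := by nlinarith
  have := mul_le_mul_of_nonneg_left hc P.C_pos.le
  rw [d_comm s1 u] at h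
  unfold Par.c1
  linarith

lemma rep2 (P : Par) (w : ℝ × ℝ → ℝ) (s1 s2 u : ℝ × ℝ) (σ : Fin P.N → ℝ × ℝ) (a b : ℝ)
    (hb : 0 ≤ b) (h1 : w u ≤ w s2 + P.l * dL1 u s2 - a)
    (h2 : dL1 s1 s2 + dL1 u s2 - b ≤ dL1 u s1) :
    F0 P w s1 u σ ≤ F0 P w s1 s2 σ - P.C * (a - b) - P.c1 * dL1 u s2 := by
  have h := F0_move P w w s1 s2 s1 u σ σ
  simp only [d_self, sub_self, mul_zero, zero_add, add_zero, Finset.sum_const_zero] at h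
  have hg2 := P.hg2
  have hg := P.hg
  unfold Par.l at h1
  have h3 := mul_le_mul_of_nonneg_left h2 (by linarith : 0 ≤ 1 - P.g)
  have h4 : 0 ≤ P.g * b := by positivity
  rw [d_comm s1 u] at h
  have hc : w s1 + w u - w s1 - w s2 - (1 - P.g) * (dL1 u s1 - dL1 s1 s2) ≤
      - P.g * dL1 u s2 - (a - b) := by nlinarith
  have := mul_le_mul_of_nonneg_left hc P.C_pos.le
  rw [d_comm s2 u] at h
  unfold Par.c1
  linarith

def SW (P : Par) (w : ℝ × ℝ → ℝ) (z : ℝ × ℝ) : Prop := ∀ u, w z ≤ w u + P.l * dL1 z u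

def Good0 (P : Par) (w : ℝ × ℝ → ℝ) (v : ℝ) : Prop := ∃ s1 s2 σ, F0 P w s1 s2 σ ≤ v

def HorC (P : Par) (w : ℝ × ℝ → ℝ) (s1 s2 z : ℝ × ℝ) (T : ℝ) : Prop :=
  SW P w z ∧ T ≤ 4 * |z.1 - s1.1| ∧ T ≤ 4 * |z.1 - s2.1| ∧
    ∀ t, T ≤ w (t, s1.2) + P.l * dL1 z (t, s1.2) - w z

def Hor (P : Par) (w : ℝ × ℝ → ℝ) (v : ℝ) : Prop := ∃ s1 s2 σ z T,
  HorC P w s1 s2 z T ∧ F0 P w s1 s2 σ - (T - P.K3 * |s1.2 - s2.2|) ≤ v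

def sw (w : ℝ × ℝ → ℝ) : ℝ × ℝ → ℝ := fun s => w s.swap

def Good (P : Par) (w : ℝ × ℝ → ℝ) (v : ℝ) : Prop :=
  Good0 P w v ∨ Hor P w v ∨ Hor P (sw w) v

lemma sw_sw (w : ℝ × ℝ → ℝ) : sw (sw w) = w := by ext s; simp [sw]

lemma F0_swap (P : Par) (w : ℝ × ℝ → ℝ) (s1 s2 : ℝ × ℝ) (σ : Fin P.N → ℝ × ℝ) :
    F0 P (sw w) s1.swap s2.swap (fun j => (σ j).swap) = F0 P w s1 s2 σ := by
  simp [F0, sw, Hf, d_swap]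

lemma Good0_swap {P : Par} {w : ℝ × ℝ → ℝ} {v : ℝ} (h : Good0 P w v) : Good0 P (sw w) v := by
  obtain ⟨s1, s2, σ, h⟩ := h
  exact ⟨s1.swap, s2.swap, fun j => (σ j).swap, by rwa [F0_swap]⟩

lemma Good_swap {P : Par} {w : ℝ × ℝ → ℝ} {v : ℝ} (h : Good P w v) : Good P (sw w) v := by
  rcases h with h | h | h
  · exact Or.inl (Good0_swap h)
  · right; right; rwa [sw_sw]
  · exact Or.inr (Or.inl h)

lemma Good0_le {P : Par} {w : ℝ × ℝ → ℝ} {v v' : ℝ} (h : Good0 P w v) (hv : v ≤ v') :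
    Good0 P w v' := by
  obtain ⟨s1, s2, σ, h⟩ := h
  exact ⟨s1, s2, σ, h.trans hv⟩

lemma Hor_le {P : Par} {w : ℝ × ℝ → ℝ} {v v' : ℝ} (h : Hor P w v) (hv : v ≤ v') :
    Hor P w v' := by
  obtain ⟨s1, s2, σ, z, T, hc, h⟩ := h
  exact ⟨s1, s2, σ, z, T, hc, h.trans hv⟩

lemma Good_le {P : Par} {w : ℝ × ℝ → ℝ} {v v' : ℝ} (h : Good P w v) (hv : v ≤ v') :
    Good P w v' := by
  rcases h with h | h | h
  · exact Or.inl (Good0_le h hv)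
  · exact Or.inr (Or.inl (Hor_le h hv))
  · exact Or.inr (Or.inr (Hor_le h hv))

structure Step (P : Par) (w w' : ℝ × ℝ → ℝ) (r0 r p : ℝ × ℝ) (δ : ℝ) : Prop where
  lip : ∀ a b, w a ≤ w b + dL1 a b
  lip' : ∀ a b, w' a ≤ w' b + dL1 a b
  att0 : ∀ s, ∃ t ∈ req r0, w s = w t + dL1 t s
  le : ∀ s, w s ≤ w' s
  eqr : ∀ s ∈ req r, w' s = w s
  att : ∀ s, ∃ t ∈ req r, w' s = w t + dL1 t s
  hp : SW P w p
  δ0 : 0 ≤ δ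
  hδ : ∀ q ∈ req r, w p + δ ≤ w q + P.l * dL1 p q

lemma req_swap {r s : ℝ × ℝ} (h : s ∈ req r) : s.swap ∈ req r.swap := Or.symm h

lemma Step.swap {P : Par} {w w' : ℝ × ℝ → ℝ} {r0 r p : ℝ × ℝ} {δ : ℝ}
    (h : Step P w w' r0 r p δ) : Step P (sw w) (sw w') r0.swap r.swap p.swap δ where
  lip a b := by have := h.lip a.swap b.swap; rwa [d_swap] at this
  lip' a b := by have := h.lip' a.swap b.swap; rwa [d_swap] at this
  att0 s := by
    obtain ⟨t, ht, e⟩ := h.att0 s.swap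
    refine ⟨t.swap, req_swap ht, ?_⟩
    simp only [sw, Prod.swap_swap]
    rw [e, ← d_swap t, Prod.swap_swap]
  le s := h.le _
  eqr s hs := h.eqr _ (by have := req_swap hs; rwa [Prod.swap_swap] at this)
  att s := by
    obtain ⟨t, ht, e⟩ := h.att s.swap
    refine ⟨t.swap, req_swap ht, ?_⟩
    simp only [sw, Prod.swap_swap]
    rw [e, ← d_swap t, Prod.swap_swap]
  hp u := by
    have := h.hp u.swap
    simp only [sw, Prod.swap_swap]
    rwa [← d_swap, Prod.swap_swap] at this
  δ0 := h.δ0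
  hδ q hq := by
    have := h.hδ q.swap (by have := req_swap hq; rwa [Prod.swap_swap] at this)
    simp only [sw, Prod.swap_swap]
    rwa [← d_swap, Prod.swap_swap] at this

lemma SW_mem {P : Par} {w : ℝ × ℝ → ℝ} {r p : ℝ × ℝ} {w0 : ℝ × ℝ → ℝ}
    (hp : SW P w p) (hle : ∀ t ∈ req r, w t ≤ w0 t)
    (hatt : ∃ t ∈ req r, w p = w0 t + dL1 t p) : p ∈ req r := by
  obtain ⟨t, ht, e⟩ := hatt
  have h1 := hp t
  have h2 := hle t ht
  have := P.hg
  unfold Par.l at h1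
  rw [d_comm p t] at h1
  have h0 := d_nonneg t p
  have : dL1 t p ≤ 0 := by nlinarith
  rwa [← d_eq_zero this]

lemma Step.p_mem {P : Par} {w w' : ℝ × ℝ → ℝ} {r0 r p : ℝ × ℝ} {δ : ℝ}
    (h : Step P w w' r0 r p δ) : p ∈ req r0 :=
  SW_mem h.hp (fun _ _ => le_rfl) (h.att0 p)

lemma Step.z_mem {P : Par} {w w' : ℝ × ℝ → ℝ} {r0 r p z : ℝ × ℝ} {δ : ℝ}
    (h : Step P w w' r0 r p δ) (hz : SW P w' z) : z ∈ req r :=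
  SW_mem hz (fun t ht => (h.eqr t ht).le) (h.att z)

lemma Step.far1 {P : Par} {w w' : ℝ × ℝ → ℝ} {r0 r p : ℝ × ℝ} {δ : ℝ}
    (h : Step P w w' r0 r p δ) (hp : p.1 = r0.1) : δ ≤ 2 * |r.1 - r0.1| := by
  have h1 := h.hδ (r.1, p.2) (Or.inl rfl)
  have h2 := h.lip (r.1, p.2) p
  have h3 : dL1 p (r.1, p.2) = |r.1 - r0.1| := by
    simp [dL1, hp, abs_sub_comm]
  rw [d_comm, h3] at h2
  rw [h3] at h1
  have := abs_nonneg (r.1 - r0.1)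
  have := P.hg
  unfold Par.l at h1
  nlinarith

lemma Step.far2 {P : Par} {w w' : ℝ × ℝ → ℝ} {r0 r p : ℝ × ℝ} {δ : ℝ}
    (h : Step P w w' r0 r p δ) (hp : p.2 = r0.2) : δ ≤ 2 * |r.2 - r0.2| :=
  h.swap.far1 hp

/-- project a configuration onto the current request. -/
lemma Step.proj {P : Par} {w w' : ℝ × ℝ → ℝ} {r0 r p : ℝ × ℝ} {δ : ℝ}
    (h : Step P w w' r0 r p δ) (s : ℝ × ℝ) : ∃ t ∈ req r, w' t = w' s - dL1 s t := by
  obtain ⟨t, ht, e⟩ := h.att s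
  exact ⟨t, ht, by rw [h.eqr t ht, e, d_comm t s]; ring⟩

lemma Step.proj0 {P : Par} {w w' : ℝ × ℝ → ℝ} {r0 r p : ℝ × ℝ} {δ : ℝ}
    (h : Step P w w' r0 r p δ) (s : ℝ × ℝ) : ∃ t ∈ req r0, w t = w s - dL1 s t := by
  obtain ⟨t, ht, e⟩ := h.att0 s
  exact ⟨t, ht, by rw [e, d_comm t s]; ring⟩

lemma grid_use (P : Par) (d1 d2 D : ℝ) (h1 : d1 - d2 ≤ D) (h2 : d2 - d1 ≤ D) (h3 : D ≤ d1 + d2)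
    (hD : 0 < D) : ∃ j, P.l * d1 - (1 - P.g) * d2 ≤ (1 - P.g) * P.θ j * D ∧
      (1 - P.g) * P.θ j * D ≤ (1 - P.g) * d1 - P.l * d2 := by
  have hg := P.hg
  have hg2 := P.hg2
  have hpos : 0 < 2 * (1 - P.g) * D := by
    have : 0 < 1 - P.g := by linarith
    positivity
  have hlpos : 0 < P.l + (1 - P.g) := by unfold Par.l; linarith
  set c := (P.l + (1 - P.g)) * (d1 - d2) / (2 * (1 - P.g) * D) with hc
  have hcD : c * (2 * (1 - P.g) * D) = (P.l + (1 - P.g)) * (d1 - d2) := by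
    rw [hc]; exact div_mul_cancel₀ _ hpos.ne'
  have hle : (P.l + (1 - P.g)) * D ≤ 2 * (1 - P.g) * D := by unfold Par.l; nlinarith
  have hc1 : |c| ≤ 1 := by
    rw [hc, abs_div, abs_of_pos hpos, div_le_one hpos, abs_mul, abs_of_pos hlpos]
    refine le_trans ?_ hle
    refine mul_le_mul_of_nonneg_left ?_ hlpos.le
    rw [abs_le]; constructor <;> linarith
  obtain ⟨j, hj⟩ := P.grid c hc1
  refine ⟨j, ?_⟩
  rw [abs_le] at hj
  have hm : 0 < (1 - P.g) * D := by linarith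
  have a1 := mul_le_mul_of_nonneg_right hj.1 hm.le
  have a2 := mul_le_mul_of_nonneg_right hj.2 hm.le
  have a3 : P.g / 2 * ((1 - P.g) * D) ≤ P.g / 2 * (d1 + d2) := by
    refine mul_le_mul_of_nonneg_left ?_ (by linarith)
    nlinarith
  unfold Par.l at hcD ⊢
  constructor <;> nlinarith

lemma F0_update (P : Par) (w : ℝ × ℝ → ℝ) (s1 s2 p : ℝ × ℝ) (σ : Fin P.N → ℝ × ℝ) (j : Fin P.N)
    (a : ℝ) (h : w p - (1 - P.g) * Hf (P.θ j) p s1 s2 ≤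
      w (σ j) - (1 - P.g) * Hf (P.θ j) (σ j) s1 s2 - a) :
    F0 P w s1 s2 (Function.update σ j p) ≤ F0 P w s1 s2 σ - a := by
  unfold F0
  rw [← Finset.add_sum_erase _ _ (Finset.mem_univ j),
    ← Finset.add_sum_erase (Finset.univ : Finset (Fin P.N))
      (fun j => w (σ j) - (1 - P.g) * Hf (P.θ j) (σ j) s1 s2) (Finset.mem_univ j)]
  have : ∑ x ∈ Finset.univ.erase j, (w (Function.update σ j p x) -
      (1 - P.g) * Hf (P.θ x) (Function.update σ j p x) s1 s2) =
      ∑ x ∈ Finset.univ.erase j, (w (σ x) - (1 - P.g) * Hf (P.θ x) (σ x) s1 s2) := by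
    refine Finset.sum_congr rfl fun x hx => ?_
    rw [Function.update_of_ne (Finset.ne_of_mem_erase hx)]
  rw [this]
  simp only [Function.update_self]
  linarith

lemma near_lem {r r0 s t : ℝ × ℝ} {ρ : ℝ} (hs : s ∈ req r) (ht : t ∈ req r0) (hd : dL1 s t < ρ)
    (hx : ρ ≤ |r.1 - r0.1|) : (s.1 = r.1 ∧ |s.2 - r0.2| < ρ) ∨
      (s.2 = r.2 ∧ (|s.1 - r0.1| < ρ ∨ |r.2 - r0.2| < ρ)) := by
  have h1 := (d_fst s t).trans_lt hd
  have h2 := (d_snd s t).trans_lt hd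
  rcases hs with hs | hs <;> rcases ht with ht | ht
  · rw [hs, ht] at h1; linarith
  · left; rw [ht] at h2; exact ⟨hs, h2⟩
  · right; rw [ht] at h1; exact ⟨hs, Or.inl h1⟩
  · right; rw [ht, hs] at h2; exact ⟨hs, Or.inr h2⟩

lemma near_d {a b c : ℝ × ℝ} {ρ : ℝ} (h1 : a.1 = c.1 ∧ |a.2 - b.2| < ρ) {a' : ℝ × ℝ}
    (h2 : a'.1 = c.1 ∧ |a'.2 - b.2| < ρ) : dL1 a a' < 2 * ρ := by
  unfold dL1
  rw [h1.1, h2.1, sub_self, abs_zero, zero_add]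
  have := abs_sub_le a.2 b.2 a'.2
  rw [abs_sub_comm b.2] at this
  linarith [h1.2, h2.2]

lemma near_d2 {a b c : ℝ × ℝ} {ρ : ℝ} (h1 : a.2 = c.2 ∧ |a.1 - b.1| < ρ) {a' : ℝ × ℝ}
    (h2 : a'.2 = c.2 ∧ |a'.1 - b.1| < ρ) : dL1 a a' < 2 * ρ := by
  unfold dL1
  rw [h1.1, h2.1, sub_self, abs_zero, add_zero]
  have := abs_sub_le a.1 b.1 a'.1
  rw [abs_sub_comm b.1] at this
  linarith [h1.2, h2.2]

/-- distance estimate for the replacement step -/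
lemma rep_dist {p s t : ℝ × ℝ} {η ε : ℝ} (h1 : |p.1 - s.1| ≤ η) (h2 : |s.2 - t.2| ≤ ε) :
    dL1 s t + dL1 p s - (2 * η + 2 * ε) ≤ dL1 p t := by
  unfold dL1
  have e1 := abs_sub_le s.1 p.1 t.1
  rw [abs_sub_comm s.1 p.1] at e1
  have e2 := abs_sub_le p.2 t.2 s.2
  rw [abs_sub_comm t.2 s.2] at e2
  linarith

set_option maxHeartbeats 2000000 in
lemma T0x {P : Par} {w w' : ℝ × ℝ → ℝ} {r0 r p : ℝ × ℝ} {δ v : ℝ}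
    (h : Step P w w' r0 r p δ) (hp : p.1 = r0.1) (hv : Good0 P w' v) :
    Good P w (v - P.κ0 * δ) := by
  obtain ⟨a1, a2, τ, hv⟩ := hv
  rcases h.δ0.eq_or_lt with hδ | hδ
  · left
    rw [← hδ]
    exact ⟨a1, a2, τ, by have := F0_mono P w' w a1 a2 τ h.le; linarith⟩
  obtain ⟨s1, m1, q1⟩ := h.proj a1
  obtain ⟨s2, m2, q2⟩ := h.proj a2
  choose σ mσ qσ using fun j => h.proj (τ j)
  have hF : F0 P w s1 s2 σ ≤ v := by
    have := F0_proj P w' w' a1 a2 s1 s2 τ σ q1.le q2.le (fun j => (qσ j).le)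
    have h2 := F0_mono P w' w s1 s2 σ h.le
    have h3 : 0 ≤ ∑ j, dL1 (τ j) (σ j) := Finset.sum_nonneg fun j _ => d_nonneg _ _
    have h4 := mul_nonneg P.hg.le h3
    have h5 : 0 ≤ P.c1 := by have := P.c1_ge; have := P.k2; linarith
    have h6 := mul_nonneg h5 (add_nonneg (d_nonneg a1 s1) (d_nonneg a2 s2))
    linarith
  clear hv q1 q2 qσ
  obtain ⟨b1, n1, q1⟩ := h.proj0 s1
  obtain ⟨b2, n2, q2⟩ := h.proj0 s2
  choose τ' nσ qσ using fun j => h.proj0 (σ j)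
  have hpr := F0_proj P w w s1 s2 b1 b2 σ τ' q1.le q2.le (fun j => (qσ j).le)
  by_cases hbig : P.κ0 * δ ≤ P.c1 * (dL1 s1 b1 + dL1 s2 b2) + P.g * ∑ j, dL1 (σ j) (τ' j)
  · exact Or.inl ⟨b1, b2, τ', by linarith⟩
  push Not at hbig
  have hg := P.hg
  have hg2 := P.hg2
  have hk := P.hk
  have hk2 := P.k2
  have hc1 := P.c1_ge
  have hCge := P.C_ge
  set ρ := P.g * δ / 1024 with hρ
  have hκ : P.κ0 * δ = P.g * ρ := by rw [hρ]; unfold Par.κ0; ring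
  have hρ0 : 0 < ρ := by positivity
  have hρδ : 2048 * ρ ≤ δ := by rw [hρ]; nlinarith
  have hκρ : P.κ0 * δ ≤ ρ := by rw [hκ]; nlinarith
  rw [hκ] at hbig
  have d1 := d_nonneg s1 b1
  have d2 := d_nonneg s2 b2
  have dσ : 0 ≤ ∑ j, dL1 (σ j) (τ' j) := Finset.sum_nonneg fun j _ => d_nonneg _ _
  have hgc : P.g ≤ P.c1 := by linarith
  have e1 : dL1 s1 b1 < ρ := by
    refine lt_of_mul_lt_mul_left ?_ hg.le
    nlinarith
  have e2 : dL1 s2 b2 < ρ := by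
    refine lt_of_mul_lt_mul_left ?_ hg.le
    nlinarith
  have eσ : ∀ j, dL1 (σ j) (τ' j) < ρ := by
    intro j
    have : dL1 (σ j) (τ' j) ≤ ∑ j, dL1 (σ j) (τ' j) :=
      Finset.single_le_sum (f := fun j => dL1 (σ j) (τ' j)) (fun j _ => d_nonneg _ _)
        (Finset.mem_univ j)
    refine lt_of_mul_lt_mul_left ?_ hg.le
    nlinarith
  have hX := h.far1 hp
  have hXρ : ρ ≤ |r.1 - r0.1| := by linarith
  have nr1 := near_lem m1 n1 e1 hXρ
  have nr2 := near_lem m2 n2 e2 hXρ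
  have nrσ := fun j => near_lem (mσ j) (nσ j) (eσ j) hXρ
  have hC1 : 1 ≤ P.C := by linarith
  by_cases hy : |r.2 - r0.2| < ρ
  · -- the two horizontal lines nearly agree
    have yb : ∀ s : ℝ × ℝ, ((s.1 = r.1 ∧ |s.2 - r0.2| < ρ) ∨
      (s.2 = r.2 ∧ (|s.1 - r0.1| < ρ ∨ |r.2 - r0.2| < ρ))) → |s.2 - r.2| ≤ 2 * ρ := by
      intro s hs
      rcases hs with hs | hs
      · have := abs_sub_le s.2 r0.2 r.2
        rw [abs_sub_comm r0.2] at this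
        linarith [hs.2]
      · rw [hs.1, sub_self, abs_zero]; linarith
    have y1 := yb s1 nr1
    have y2 := yb s2 nr2
    have y12 : |s1.2 - s2.2| ≤ 4 * ρ := by
      have := abs_sub_le s1.2 r.2 s2.2
      rw [abs_sub_comm r.2] at this
      linarith
    by_cases c1 : |p.1 - s1.1| ≤ δ / 8
    · left
      have := rep1 P w s1 s2 p σ δ (2 * (δ / 8) + 2 * (4 * ρ)) (by linarith)
        (by linarith [h.hδ s1 m1]) (rep_dist c1 y12)
      have hd := mul_nonneg (by linarith : 0 ≤ P.c1) (d_nonneg p s1)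
      refine ⟨p, s2, σ, ?_⟩
      have hh : δ / 2 ≤ δ - (2 * (δ / 8) + 2 * (4 * ρ)) := by linarith
      have hh2 := mul_le_mul hC1 hh (by linarith) (by linarith)
      linarith
    by_cases c2 : |p.1 - s2.1| ≤ δ / 8
    · left
      have hr := rep_dist c2 (by rwa [abs_sub_comm] : |s2.2 - s1.2| ≤ 4 * ρ)
      rw [d_comm s2 s1] at hr
      have := rep2 P w s1 s2 p σ δ (2 * (δ / 8) + 2 * (4 * ρ)) (by linarith)
        (by linarith [h.hδ s2 m2]) hr
      have hd := mul_nonneg (by linarith : 0 ≤ P.c1) (d_nonneg p s2)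
      refine ⟨s1, p, σ, ?_⟩
      have hh : δ / 2 ≤ δ - (2 * (δ / 8) + 2 * (4 * ρ)) := by linarith
      have hh2 := mul_le_mul hC1 hh (by linarith) (by linarith)
      linarith
    push Not at c1 c2
    right; left
    refine ⟨s1, s2, σ, p, δ / 2, ⟨h.hp, by linarith, by linarith, ?_⟩, ?_⟩
    · intro t
      have f1 := h.hδ (t, r.2) (Or.inr rfl)
      have f2 := h.lip (t, r.2) (t, s1.2)
      have f3 := d_tri p (t, s1.2) (t, r.2)
      have f4 : dL1 (t, s1.2) (t, r.2) ≤ 2 * ρ := by simpa [dL1] using y1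
      rw [d_comm (t, r.2)] at f2
      have f5 := d_nonneg (t, s1.2) (t, r.2)
      have f6 := mul_le_mul_of_nonneg_left f3 (by unfold Par.l; linarith : 0 ≤ P.l)
      have f7 : P.l * dL1 (t, s1.2) (t, r.2) ≤ dL1 (t, s1.2) (t, r.2) := by
        unfold Par.l; nlinarith
      linarith
    · have : P.K3 * |s1.2 - s2.2| ≤ P.K3 * (4 * ρ) := by
        refine mul_le_mul_of_nonneg_left y12 ?_
        unfold Par.K3; linarith
      have h3 : P.K3 * (4 * ρ) = δ / 4 := by
        rw [hρ]; unfold Par.K3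
        linear_combination (δ / 4) * hk
      linarith
  · -- all points are near two corners
    have simp_near : ∀ s : ℝ × ℝ, ((s.1 = r.1 ∧ |s.2 - r0.2| < ρ) ∨
      (s.2 = r.2 ∧ (|s.1 - r0.1| < ρ ∨ |r.2 - r0.2| < ρ))) →
        ((s.1 = r.1 ∧ |s.2 - r0.2| < ρ) ∨ (s.2 = r.2 ∧ |s.1 - r0.1| < ρ)) := by
      intro s hs; tauto
    replace nr1 := simp_near s1 nr1
    replace nr2 := simp_near s2 nr2
    replace nrσ := fun j => simp_near (σ j) (nrσ j)
    left
    by_cases hD : dL1 s1 s2 ≤ 2 * ρ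
    · have t1 := d_tri p s2 s1
      rw [d_comm s2 s1] at t1
      have := rep1 P w s1 s2 p σ δ (2 * dL1 s1 s2) (by linarith [d_nonneg s1 s2])
        (by linarith [h.hδ s1 m1]) (by linarith)
      have hd := mul_nonneg (by linarith : 0 ≤ P.c1) (d_nonneg p s1)
      refine ⟨p, s2, σ, ?_⟩
      have hh : δ / 2 ≤ δ - 2 * dL1 s1 s2 := by linarith
      have hh2 := mul_le_mul hC1 hh (by linarith) (by linarith)
      linarith
    push Not at hD
    have hn : ∀ j, dL1 (σ j) s1 < 2 * ρ ∨ dL1 (σ j) s2 < 2 * ρ := by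
      intro j
      rcases nr1 with g1 | g1 <;> rcases nr2 with g2 | g2 <;> rcases nrσ j with g3 | g3
      · exact Or.inl (near_d g3 g1)
      · linarith [near_d g1 g2]
      · exact Or.inl (near_d g3 g1)
      · exact Or.inr (near_d2 g3 g2)
      · exact Or.inr (near_d g3 g2)
      · exact Or.inl (near_d2 g3 g1)
      · linarith [near_d2 g1 g2]
      · exact Or.inl (near_d2 g3 g1)
    have t1 := d_tri p s1 s2
    have t2 := d_tri p s2 s1
    have t3 := d_tri s1 p s2
    rw [d_comm s2 s1] at t2
    rw [d_comm s1 p] at t3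
    obtain ⟨j, g1, g2⟩ := grid_use P (dL1 p s1) (dL1 p s2) (dL1 s1 s2) (by linarith) (by linarith)
      (by linarith) (by linarith)
    have f1 := h.hδ s1 m1
    have f2 := h.hδ s2 m2
    have p1 := d_nonneg p s1
    have p2 := d_nonneg p s2
    have := F0_update P w s1 s2 p σ j (δ - 4 * ρ) ?_
    · exact ⟨s1, s2, _, by linarith⟩
    have hmin : ∀ A, A ≤ (1 - P.g) * (dL1 p s1 - P.θ j * dL1 s1 s2) → A ≤ (1 - P.g) * dL1 p s2 →
        A ≤ (1 - P.g) * Hf (P.θ j) p s1 s2 := by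
      intro A h1 h2
      unfold Hf
      rcases min_choice (dL1 p s1 - P.θ j * dL1 s1 s2) (dL1 p s2) with h | h <;> rw [h] <;>
        assumption
    rcases hn j with hj | hj
    · have u1 : Hf (P.θ j) (σ j) s1 s2 ≤ 2 * ρ - P.θ j * dL1 s1 s2 :=
        (min_le_left _ _).trans (by linarith)
      have u2 := mul_le_mul_of_nonneg_left u1 (by linarith : 0 ≤ 1 - P.g)
      have u3 := h.lip s1 (σ j)
      rw [d_comm s1] at u3
      have u4 := hmin (P.l * dL1 p s1 - (1 - P.g) * P.θ j * dL1 s1 s2)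
        (by unfold Par.l; nlinarith) (by linarith)
      nlinarith
    · have u1 : Hf (P.θ j) (σ j) s1 s2 ≤ 2 * ρ :=
        (min_le_right _ _).trans (by linarith)
      have u2 := mul_le_mul_of_nonneg_left u1 (by linarith : 0 ≤ 1 - P.g)
      have u3 := h.lip s2 (σ j)
      rw [d_comm s2] at u3
      have u4 := hmin (P.l * dL1 p s2)
        (by linarith) (by unfold Par.l; nlinarith)
      nlinarith

lemma T0 {P : Par} {w w' : ℝ × ℝ → ℝ} {r0 r p : ℝ × ℝ} {δ v : ℝ}
    (h : Step P w w' r0 r p δ) (hv : Good0 P w' v) :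
    Good P w (v - P.κ0 * δ) := by
  rcases h.p_mem with hp | hp
  · exact T0x h hp hv
  · have := Good_swap (T0x h.swap (by simpa using hp) (Good0_swap hv))
    rwa [sw_sw] at this

lemma HorC_move {P : Par} {w : ℝ × ℝ → ℝ} {s1 s2 z : ℝ × ℝ} {T : ℝ} (s1' s2' : ℝ × ℝ)
    (hl : ∀ a b, w a ≤ w b + dL1 a b) (h : HorC P w s1 s2 z T) :
    HorC P w s1' s2' z (T - 4 * (dL1 s1 s1' + dL1 s2 s2')) := by
  obtain ⟨h1, h2, h3, h4⟩ := h
  have n1 := d_nonneg s1 s1'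
  have n2 := d_nonneg s2 s2'
  refine ⟨h1, ?_, ?_, ?_⟩
  · have e := abs_sub_le z.1 s1'.1 s1.1
    rw [abs_sub_comm s1'.1] at e
    linarith [d_fst s1 s1']
  · have e := abs_sub_le z.1 s2'.1 s2.1
    rw [abs_sub_comm s2'.1] at e
    linarith [d_fst s2 s2']
  · intro t
    have a1 := h4 t
    have a2 := hl (t, s1.2) (t, s1'.2)
    have a3 := d_tri z (t, s1'.2) (t, s1.2)
    have a4 : dL1 (t, s1.2) (t, s1'.2) ≤ dL1 s1 s1' := by
      have := d_snd s1 s1'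
      simpa [dL1] using this
    rw [d_comm (t, s1'.2)] at a3
    have hg := P.hg
    have hg2 := P.hg2
    have a5 := mul_le_mul_of_nonneg_left a3 (by unfold Par.l; linarith : 0 ≤ P.l)
    have a6 : P.l * dL1 (t, s1.2) (t, s1'.2) ≤ dL1 (t, s1.2) (t, s1'.2) := by
      have := d_nonneg (t, s1.2) (t, s1'.2)
      unfold Par.l; nlinarith
    linarith

/-- Replacing `s2` by a far away point of `S_w` is very profitable when `s1`, `s2` are close. -/
lemma rep_far {P : Par} {w : ℝ × ℝ → ℝ} {s1 s2 z : ℝ × ℝ} {σ : Fin P.N → ℝ × ℝ} {T v : ℝ}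
    (hz : SW P w z) (hT : 0 ≤ T) (hD : dL1 s1 s2 ≤ P.g * T / 16)
    (hd : 3 * T / 8 ≤ dL1 z s2) (hF : F0 P w s1 s2 σ - T ≤ v) : Good0 P w v := by
  refine ⟨s1, z, σ, ?_⟩
  have t1 := d_tri z s1 s2
  have h := rep2 P w s1 s2 z σ 0 (2 * dL1 s1 s2) (by linarith [d_nonneg s1 s2])
    (by linarith [hz s2]) (by linarith)
  have hC := P.C_pos
  have hc := P.c1_ge
  have hk := P.k2
  have hCg := P.Cg_le
  have a1 : P.C * dL1 s1 s2 ≤ P.C * (P.g * T / 16) := mul_le_mul_of_nonneg_left hD hC.le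
  have a2 : P.C * P.g * T ≤ 2 * P.c1 * T := mul_le_mul_of_nonneg_right hCg hT
  have a3 : P.c1 * (3 * T / 8) ≤ P.c1 * dL1 z s2 := mul_le_mul_of_nonneg_left hd (by linarith)
  have a4 : 200 * T ≤ P.c1 * T := mul_le_mul_of_nonneg_right (by linarith) hT
  linarith

lemma line_bound {P : Par} {w : ℝ × ℝ → ℝ} {s1 s2 z : ℝ × ℝ} {T : ℝ}
    (hl : ∀ a b, w a ≤ w b + dL1 a b) (h : HorC P w s1 s2 z T) : T ≤ 2 * |z.2 - s1.2| := by
  have h1 := h.2.2.2 z.1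
  have h2 := hl (z.1, s1.2) z
  have h3 : dL1 z (z.1, s1.2) = |z.2 - s1.2| := by simp [dL1]
  rw [d_comm, h3] at h2
  rw [h3] at h1
  have := abs_nonneg (z.2 - s1.2)
  have := P.hg
  unfold Par.l at h1
  nlinarith

set_option maxHeartbeats 2000000 in
/-- last stage: both service points on the horizontal line, `z` on the vertical one -/
lemma THx {P : Par} {w w' : ℝ × ℝ → ℝ} {r0 r p : ℝ × ℝ} {δ v T : ℝ}
    (h : Step P w w' r0 r p δ) {s1 s2 z : ℝ × ℝ} {σ : Fin P.N → ℝ × ℝ}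
    (hH : HorC P w' s1 s2 z T) (hF : F0 P w' s1 s2 σ - T ≤ v)
    (h1 : s1.2 = r.2) (h2 : s2.2 = r.2) (hz1 : z.1 = r.1) (hT : 0 < T) :
    Good P w (v - P.κ0 / 2 * δ) := by
  have hδ0 := h.δ0
  have hg := P.hg
  have hg2 := P.hg2
  have hk := P.hk
  have hk2 := P.k2
  have hc1 := P.c1_ge
  have hCge := P.C_ge
  have hκ : P.κ0 / 2 * δ ≤ P.g * δ := by
    refine mul_le_mul_of_nonneg_right ?_ hδ0
    unfold Par.κ0; nlinarith
  have hκδ : 0 ≤ P.κ0 * δ := by unfold Par.κ0; positivity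
  have hTl : T ≤ 2 * |z.2 - r.2| := h1 ▸ line_bound h.lip' hH
  by_cases hsmall : T ≤ P.κ0 * δ / 2
  · exact Good_le (T0 h (v := v + T) ⟨s1, s2, σ, by linarith⟩) (by linarith)
  push Not at hsmall
  obtain ⟨b1, n1, q1⟩ := h.proj0 s1
  obtain ⟨b2, n2, q2⟩ := h.proj0 s2
  have hmono := F0_mono P w' w s1 s2 σ h.le
  have hpr := F0_proj P w w s1 s2 b1 b2 σ σ q1.le q2.le (fun j => by simp [d_self])
  simp only [d_self, Finset.sum_const_zero, mul_zero, sub_zero] at hpr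
  have hn1 := d_nonneg s1 b1
  have hn2 := d_nonneg s2 b2
  set e := dL1 s1 b1 + dL1 s2 b2 with he
  have he0 : 0 ≤ e := by linarith
  by_cases hbig : P.g * T / 16 ≤ e
  · refine Or.inl ⟨b1, b2, σ, ?_⟩
    have a1 : 100 * P.k * (P.g * T / 16) ≤ P.c1 * e :=
      mul_le_mul (by linarith) hbig (by positivity) (by linarith)
    have a2 : 100 * P.k * (P.g * T / 16) = 100 / 16 * T := by
      linear_combination (100 / 16 * T) * hk
    linarith
  push Not at hbig
  have hs12 : dL1 s1 s2 = |s1.1 - s2.1| := by simp [dL1, h1, h2]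
  by_cases hcase : b1.1 = r0.1 ∧ b2.1 = r0.1
  · have hD : dL1 s1 s2 ≤ e := by
      rw [hs12]
      have := abs_sub_le s1.1 r0.1 s2.1
      have f1 := d_fst s1 b1
      have f2 := d_fst s2 b2
      rw [hcase.1] at f1
      rw [hcase.2, abs_sub_comm] at f2
      linarith
    have hd : 3 * T / 8 ≤ dL1 z s2 := by
      have := d_snd z s2
      rw [h2] at this
      linarith
    exact Good_le (T0 h (rep_far (s1 := s1) (σ := σ) hH.1 hT.le (by linarith) hd hF)) (by linarith)
  have hy : |r.2 - r0.2| ≤ e := by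
    by_cases hb : b1.1 = r0.1
    · have hb2 : b2.2 = r0.2 := n2.resolve_left fun hh => hcase ⟨hb, hh⟩
      have := d_snd s2 b2
      rw [h2, hb2] at this
      linarith
    · have hb1 : b1.2 = r0.2 := n1.resolve_left hb
      have := d_snd s1 b1
      rw [h1, hb1] at this
      linarith
  have hTe : 32 * e ≤ T := by nlinarith
  set Y := |r.2 - r0.2| with hY
  set X := |r.1 - r0.1| with hX
  have hX0 : 0 ≤ X := abs_nonneg _
  have hY0 : 0 ≤ Y := abs_nonneg _
  have hl0 : 0 ≤ P.l := by unfold Par.l; linarith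
  have hl1 : P.l ≤ 1 := by unfold Par.l; linarith
  have hwz : w' z = w z := h.eqr z (Or.inl hz1)
  have hline : ∀ t, T ≤ w (t, r.2) + P.l * dL1 z (t, r.2) - w z := by
    intro t
    have := hH.2.2.2 t
    rwa [h1, h.eqr (t, r.2) (Or.inr rfl), hwz] at this
  have hcol : ∀ t, w z ≤ w (r.1, t) + P.l * |z.2 - t| := by
    intro t
    have := hH.1 (r.1, t)
    rw [h.eqr (r.1, t) (Or.inl rfl), hwz] at this
    simpa [dL1, hz1] using this
  -- the predecessor of z
  obtain ⟨zb, hzb1, hzb2, hwzb⟩ : ∃ zb : ℝ × ℝ, zb.1 = r0.1 ∧ zb.2 = z.2 ∧ w z = w zb + X := by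
    obtain ⟨t, ht, et⟩ := h.att0 z
    have ht1 : t.1 = r0.1 := by
      refine ht.resolve_right fun ht2 => ?_
      have a1 := hline t.1
      have a2 := h.lip (t.1, r.2) t
      have a3 : dL1 (t.1, r.2) t = Y := by simp [dL1, ht2, hY]
      have a4 := d_tri z t (t.1, r.2)
      rw [d_comm t, a3] at a4
      rw [a3] at a2
      have a5 := mul_le_mul_of_nonneg_left a4 hl0
      have a6 : P.l * (dL1 z t + Y) ≤ dL1 z t + Y :=
        mul_le_of_le_one_left (by linarith [d_nonneg z t]) hl1
      rw [d_comm t z] at et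
      linarith
    have a1 := hcol t.2
    have a2 := h.lip (r.1, t.2) t
    have a3 : dL1 (r.1, t.2) t = X := by simp [dL1, ht1, hX]
    have a4 : dL1 t z = X + |z.2 - t.2| := by
      simp only [dL1, ht1, hz1, hX]
      rw [abs_sub_comm r0.1, abs_sub_comm t.2]
    rw [a3] at a2
    rw [a4] at et
    have a5 := abs_nonneg (z.2 - t.2)
    have a6 : |z.2 - t.2| ≤ 0 := by
      unfold Par.l at a1
      nlinarith
    have a7 := abs_nonpos_iff.1 a6
    refine ⟨t, ht1, by linarith, ?_⟩
    linarith
  -- distances from z and its predecessor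
  have hzd : ∀ u, dL1 z u ≤ X + dL1 zb u := by
    intro u
    have := d_tri z zb u
    have h3 : dL1 z zb = X := by simp [dL1, hzb1, hzb2, hz1, hX]
    linarith
  have hzbS : SW P w zb := by
    intro u
    obtain ⟨t, ht, et⟩ := h.att0 u
    suffices hs : w zb ≤ w t + P.l * dL1 zb t by
      have a1 := d_tri zb u t
      rw [d_comm u t] at a1
      have a2 := mul_le_mul_of_nonneg_left a1 hl0
      have a3 : P.l * dL1 t u ≤ dL1 t u := mul_le_of_le_one_left (d_nonneg t u) hl1
      linarith
    rcases ht with ht | ht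
    · have a1 := hcol t.2
      have a2 := h.lip (r.1, t.2) t
      have a3 : dL1 (r.1, t.2) t = X := by simp [dL1, ht, hX]
      have a4 : dL1 zb t = |z.2 - t.2| := by simp [dL1, ht, hzb1, hzb2]
      rw [a4]
      linarith
    · have a1 := hline t.1
      have a2 := h.lip (t.1, r.2) t
      have a3 : dL1 (t.1, r.2) t = Y := by simp [dL1, ht, hY]
      have a4 := hzd (t.1, r.2)
      have a5 := d_tri zb t (t.1, r.2)
      rw [d_comm t, a3] at a5
      have a6 := mul_le_mul_of_nonneg_left (a4.trans (add_le_add_right a5 X)) hl0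
      have a7 : P.l * X ≤ X := mul_le_of_le_one_left hX0 hl1
      have a8 : P.l * Y ≤ Y := mul_le_of_le_one_left hY0 hl1
      linarith
  set G := 2 * P.g * X with hG
  have hG0 : 0 ≤ G := by positivity
  have hlineb : ∀ t, T + G ≤ w (t, r.2) + P.l * dL1 zb (t, r.2) - w zb := by
    intro t
    have a1 := hline t
    have a2 := mul_le_mul_of_nonneg_left (hzd (t, r.2)) hl0
    have a3 : P.l * X = X - G := by rw [hG]; unfold Par.l; ring
    linarith
  have hs1 : s1 = (s1.1, r.2) := by rw [← h1]
  have hs2 : s2 = (s2.1, r.2) := by rw [← h2]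
  by_cases c1 : 4 * |zb.1 - s1.1| < T + G
  · left
    have a1 := hlineb s1.1
    rw [← hs1] at a1
    have a2 := rep1 P w s1 s2 zb σ (T + G) (2 * |zb.1 - s1.1| + 2 * 0) (by positivity)
      (by linarith) (rep_dist le_rfl (by simp [h1, h2]))
    have hd := mul_nonneg (by linarith : 0 ≤ P.c1) (d_nonneg zb s1)
    refine ⟨zb, s2, σ, ?_⟩
    have hh2 : 4 * (T / 2) ≤ P.C * (T + G - (2 * |zb.1 - s1.1| + 2 * 0)) :=
      mul_le_mul (by linarith) (by linarith) (by linarith) (by linarith)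
    linarith
  by_cases c2 : 4 * |zb.1 - s2.1| < T + G
  · left
    have a1 := hlineb s2.1
    rw [← hs2] at a1
    have hr : dL1 s2 s1 + dL1 zb s2 - (2 * |zb.1 - s2.1| + 2 * 0) ≤ dL1 zb s1 :=
      rep_dist le_rfl (by simp [h1, h2])
    rw [d_comm s2 s1] at hr
    have a2 := rep2 P w s1 s2 zb σ (T + G) (2 * |zb.1 - s2.1| + 2 * 0) (by positivity)
      (by linarith) hr
    have hd := mul_nonneg (by linarith : 0 ≤ P.c1) (d_nonneg zb s2)
    refine ⟨s1, zb, σ, ?_⟩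
    have hh2 : 4 * (T / 2) ≤ P.C * (T + G - (2 * |zb.1 - s2.1| + 2 * 0)) :=
      mul_le_mul (by linarith) (by linarith) (by linarith) (by linarith)
    linarith
  push Not at c1 c2
  right; left
  have hHb : HorC P w s1 s2 zb (T + G) := ⟨hzbS, c1, c2, by rw [h1]; exact hlineb⟩
  refine ⟨b1, b2, σ, zb, _, HorC_move b1 b2 h.lip hHb, ?_⟩
  rw [← he]
  have hbb : |b1.2 - b2.2| ≤ e := by
    have f1 := d_snd s1 b1
    have f2 := d_snd s2 b2
    rw [h1, abs_sub_comm] at f1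
    rw [h2] at f2
    linarith [abs_sub_le b1.2 r.2 b2.2]
  have hK : P.K3 * |b1.2 - b2.2| ≤ P.K3 * e := by
    refine mul_le_mul_of_nonneg_left hbb ?_
    unfold Par.K3; linarith
  have hce : (P.K3 + 5) * e ≤ P.c1 * e := by
    refine mul_le_mul_of_nonneg_right ?_ he0
    unfold Par.K3; linarith
  have hgain : P.g * δ ≤ e + G := by
    rcases h.p_mem with hp | hp
    · have f := h.far1 hp
      rw [← hX] at f
      have : P.g * δ ≤ P.g * (2 * X) := mul_le_mul_of_nonneg_left f hg.le
      rw [hG]; linarith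
    · have f := h.far2 hp
      rw [← hY] at f
      nlinarith
  linarith

lemma TH {P : Par} {w w' : ℝ × ℝ → ℝ} {r0 r p : ℝ × ℝ} {δ v : ℝ}
    (h : Step P w w' r0 r p δ) (hv : Hor P w' v) :
    Good P w (v - P.κ0 / 2 * δ) := by
  obtain ⟨a1, a2, τ, z, T0', hH, hF⟩ := hv
  have hδ0 := h.δ0
  have hg := P.hg
  have hg2 := P.hg2
  have hk := P.hk
  have hk2 := P.k2
  have hc1 := P.c1_ge
  have hκδ : 0 ≤ P.κ0 * δ := by unfold Par.κ0; positivity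
  obtain ⟨s1, m1, q1⟩ := h.proj a1
  obtain ⟨s2, m2, q2⟩ := h.proj a2
  choose σ mσ qσ using fun j => h.proj (τ j)
  have hpr := F0_proj P w' w' a1 a2 s1 s2 τ σ q1.le q2.le (fun j => (qσ j).le)
  have hH' := HorC_move s1 s2 h.lip' hH
  have hn1 := d_nonneg a1 s1
  have hn2 := d_nonneg a2 s2
  set e := dL1 a1 s1 + dL1 a2 s2 with he
  have he0 : 0 ≤ e := by linarith
  set T := T0' - 4 * e with hT
  have hF' : F0 P w' s1 s2 σ - (T - P.K3 * |s1.2 - s2.2|) ≤ v := by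
    have h3 : 0 ≤ ∑ j, dL1 (τ j) (σ j) := Finset.sum_nonneg fun j _ => d_nonneg _ _
    have h4 := mul_nonneg P.hg.le h3
    have hce : (P.K3 + 4) * e ≤ P.c1 * e := by
      refine mul_le_mul_of_nonneg_right ?_ he0
      unfold Par.K3; linarith
    have hbb : |s1.2 - s2.2| ≤ |a1.2 - a2.2| + e := by
      have f1 := d_snd a1 s1
      have f2 := d_snd a2 s2
      rw [abs_sub_comm] at f1
      linarith [abs_sub_le s1.2 a1.2 s2.2, abs_sub_le a1.2 a2.2 s2.2]
    have hK : P.K3 * |s1.2 - s2.2| ≤ P.K3 * (|a1.2 - a2.2| + e) := by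
      refine mul_le_mul_of_nonneg_left hbb ?_
      unfold Par.K3; linarith
    linarith
  clear_value T e
  clear hpr hF hH q1 q2 qσ
  by_cases hh : T - P.K3 * |s1.2 - s2.2| ≤ 0
  · exact Good_le (T0 h (v := v) ⟨s1, s2, σ, by linarith⟩) (by linarith)
  push Not at hh
  have hK0 : 128 ≤ P.K3 := by unfold Par.K3; linarith
  have hab := abs_nonneg (s1.2 - s2.2)
  have hTpos : 0 < T := by nlinarith
  have hz := h.z_mem hH'.1
  rcases hz with hz | hz
  · have h1 : s1.2 = r.2 := by
      refine m1.resolve_left fun hs => ?_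
      have := hH'.2.1
      rw [hz, hs, sub_self, abs_zero] at this
      linarith
    have h2 : s2.2 = r.2 := by
      refine m2.resolve_left fun hs => ?_
      have := hH'.2.2.1
      rw [hz, hs, sub_self, abs_zero] at this
      linarith
    refine THx h hH' (σ := σ) ?_ h1 h2 hz hTpos
    rw [h1, h2, sub_self, abs_zero, mul_zero, sub_zero] at hF'
    exact hF'
  · have hl := line_bound h.lip' hH'
    rw [hz] at hl
    have h1 : s1.1 = r.1 := by
      refine m1.resolve_right fun hs => ?_
      rw [hs, sub_self, abs_zero] at hl
      linarith
    have h2 : s2.1 = r.1 := by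
      refine m2.resolve_right fun hs => ?_
      rw [hs, abs_sub_comm] at hh
      nlinarith [abs_nonneg (r.2 - s1.2)]
    have hD : dL1 s1 s2 = |s1.2 - s2.2| := by simp [dL1, h1, h2]
    have hKD : 64 * |s1.2 - s2.2| ≤ P.g * T := by
      have : P.g * (P.K3 * |s1.2 - s2.2|) ≤ P.g * T := mul_le_mul_of_nonneg_left (by linarith) hg.le
      have h3 : P.g * (P.K3 * |s1.2 - s2.2|) = 64 * |s1.2 - s2.2| := by
        unfold Par.K3; linear_combination (64 * |s1.2 - s2.2|) * hk
      linarith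
    have hgT : P.g * T ≤ T / 2 := by nlinarith
    have hd : 3 * T / 8 ≤ dL1 z s2 := by
      have f1 := d_snd z s2
      rw [hz] at f1
      have f2 := abs_sub_le r.2 s2.2 s1.2
      rw [abs_sub_comm s2.2] at f2
      linarith
    have hK3 : 0 ≤ P.K3 * |s1.2 - s2.2| := by positivity
    exact Good_le (T0 h (v := v) (rep_far (s1 := s1) (σ := σ) hH'.1 hTpos.le (by linarith) hd (by linarith)))
      (by linarith)

lemma step_lemma {P : Par} {w w' : ℝ × ℝ → ℝ} {r0 r p : ℝ × ℝ} {δ v : ℝ}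
    (h : Step P w w' r0 r p δ) (hv : Good P w' v) :
    Good P w (v - P.κ0 / 2 * δ) := by
  rcases hv with hv | hv | hv
  · refine Good_le (T0 h hv) ?_
    have := h.δ0
    have hκδ : 0 ≤ P.κ0 * δ := by unfold Par.κ0; positivity
    linarith
  · exact TH h hv
  · have := Good_swap (TH h.swap hv)
    rwa [sw_sw] at this

/-! ### Conclusion -/

lemma par_exists (lam : ℝ) (h0 : 0 < lam) (h1 : lam < 1) : ∃ P : Par, P.l = lam := by
  set g := (1 - lam) / 2 with hg
  have hg0 : 0 < g := by rw [hg]; linarith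
  have hg2 : g < 1 / 2 := by rw [hg]; linarith
  obtain ⟨n, hn⟩ := exists_nat_ge (4 / g)
  have hn0 : (0 : ℝ) < n := lt_of_lt_of_le (by positivity) hn
  have hng : 4 ≤ n * g := by rwa [div_le_iff₀ hg0] at hn
  refine ⟨{ g := g, C := (4 * ((n + 1 : ℕ) : ℝ) + 100 * (1 / g)) / g, k := 1 / g, N := n + 1,
            θ := fun j => -1 + 2 * (j : ℕ) / n, hg := hg0, hg2 := hg2, hk := by field_simp,
            hN := by omega, hC := by field_simp, hθ := ?_, grid := ?_ }, ?_⟩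
  · intro j
    have hj : ((j : ℕ) : ℝ) ≤ n := by exact_mod_cast Nat.lt_succ_iff.1 j.2
    have : (j : ℕ) / (n : ℝ) ≤ 1 := by rwa [div_le_one hn0]
    have h3 : 0 ≤ (j : ℕ) / (n : ℝ) := by positivity
    rw [abs_le, mul_div_assoc]
    constructor <;> linarith
  · intro c hc
    rw [abs_le] at hc
    have ha : 0 ≤ (c + 1) * n / 2 := by
      have : 0 ≤ c + 1 := by linarith
      positivity
    have hle : ⌊(c + 1) * n / 2⌋₊ ≤ n := by
      apply Nat.floor_le_of_le
      nlinarith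
    refine ⟨⟨⌊(c + 1) * n / 2⌋₊, Nat.lt_succ_of_le hle⟩, ?_⟩
    have f1 := Nat.floor_le ha
    have f2 := Nat.lt_floor_add_one ((c + 1) * n / 2)
    set m : ℝ := (⌊(c + 1) * n / 2⌋₊ : ℝ) with hm
    have e1 : -1 + 2 * m / n - c = (2 * m - (c + 1) * n) / n := by field_simp; ring
    show |-1 + 2 * m / n - c| ≤ g / 2
    rw [e1, abs_div, abs_of_pos hn0, div_le_iff₀ hn0, abs_le]
    constructor <;> linarith
  · simp only [Par.l, hg]; ring

lemma Hor_zero {P : Par} {O : ℝ × ℝ} {w : ℝ × ℝ → ℝ} (hw : ∀ s, w s = dL1 O s)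
    (s1 s2 : ℝ × ℝ) (σ : Fin P.N → ℝ × ℝ) :
    4 * (dL1 O s1 + dL1 O s2) ≤ F0 P w s1 s2 σ := by
  have hg := P.hg
  have hg2 := P.hg2
  have hk2 := P.k2
  have hN : (1 : ℝ) ≤ P.N := by exact_mod_cast P.hN
  have t := d_tri s1 O s2
  rw [d_comm s1 O] at t
  have n1 := d_nonneg O s1
  have n2 := d_nonneg O s2
  have hs : ∑ _j : Fin P.N, (-(dL1 O s1 + dL1 O s2)) ≤
      ∑ j, (w (σ j) - (1 - P.g) * Hf (P.θ j) (σ j) s1 s2) := by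
    refine Finset.sum_le_sum fun j _ => ?_
    have a1 : Hf (P.θ j) (σ j) s1 s2 ≤ dL1 O (σ j) + (dL1 O s1 + dL1 O s2) := by
      refine (min_le_right _ _).trans ?_
      have := d_tri (σ j) O s2
      rw [d_comm (σ j) O] at this
      linarith
    have a2 := mul_le_mul_of_nonneg_left a1 (by linarith : 0 ≤ 1 - P.g)
    have a3 : (1 - P.g) * (dL1 O (σ j) + (dL1 O s1 + dL1 O s2)) ≤
        dL1 O (σ j) + (dL1 O s1 + dL1 O s2) :=
      mul_le_of_le_one_left (by linarith [d_nonneg O (σ j)]) (by linarith)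
    rw [hw]
    linarith
  simp only [Finset.sum_const, Finset.card_univ, Fintype.card_fin, nsmul_eq_mul] at hs
  unfold F0
  have b1 := mul_le_mul_of_nonneg_left t (by linarith : 0 ≤ 1 - P.g)
  have b2 : P.g * (dL1 O s1 + dL1 O s2) ≤ w s1 + w s2 - (1 - P.g) * dL1 s1 s2 := by
    rw [hw, hw]; linarith
  have b3 := mul_le_mul_of_nonneg_left b2 P.C_pos.le
  have b4 : P.C * (P.g * (dL1 O s1 + dL1 O s2)) = (4 * P.N + 100 * P.k) * (dL1 O s1 + dL1 O s2) := by
    rw [← P.hC]; ring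
  have b5 : (4 + P.N) * (dL1 O s1 + dL1 O s2) ≤ (4 * P.N + 100 * P.k) * (dL1 O s1 + dL1 O s2) :=
    mul_le_mul_of_nonneg_right (by linarith) (by linarith)
  linarith

lemma Hor_nonneg {P : Par} {O : ℝ × ℝ} {w : ℝ × ℝ → ℝ} (hw : ∀ s, w s = dL1 O s) {v : ℝ}
    (hv : Hor P w v) : 0 ≤ v := by
  obtain ⟨s1, s2, σ, z, T, hH, hF⟩ := hv
  have h1 := Hor_zero hw s1 s2 σ
  have h2 := hH.2.2.2 s1.1
  have h3 := hH.1
  have n1 := d_nonneg O s1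
  have n2 := d_nonneg O s2
  have hl0 : 0 ≤ P.l := by have := P.hg2; unfold Par.l; linarith
  have hl1 : P.l ≤ 1 := by have := P.hg; unfold Par.l; linarith
  have hK : 0 ≤ P.K3 * |s1.2 - s2.2| := by
    have := P.k2
    have : 0 ≤ P.K3 := by unfold Par.K3; linarith
    positivity
  have h4 : P.l * dL1 z s1 ≤ dL1 z s1 := mul_le_of_le_one_left (d_nonneg _ _) hl1
  have h5 := d_tri z O s1
  rw [d_comm z O] at h5
  change T ≤ w s1 + P.l * dL1 z s1 - w z at h2
  rw [hw, hw] at h2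
  linarith

lemma Good_nonneg {P : Par} {O : ℝ × ℝ} {w : ℝ × ℝ → ℝ} (hw : ∀ s, w s = dL1 O s) {v : ℝ}
    (hv : Good P w v) : 0 ≤ v := by
  rcases hv with hv | hv | hv
  · obtain ⟨s1, s2, σ, hF⟩ := hv
    have h1 := Hor_zero hw s1 s2 σ
    linarith [d_nonneg O s1, d_nonneg O s2]
  · exact Hor_nonneg hw hv
  · refine Hor_nonneg (O := O.swap) (w := sw w) (fun s => ?_) hv
    rw [← d_swap, Prod.swap_swap]
    exact hw _

lemma run_step {P : Par} {O : ℝ × ℝ} {σ : List (ℝ × ℝ)} {s : ℕ → ℝ × ℝ}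
    (hr : IsWFARun P.l O σ s) (i : ℕ) (hi : i < σ.length) :
    ∃ r0 r, Step P (WF O (σ.take i)) (WF O (σ.take (i + 1))) r0 r (s i)
      (WF O (σ.take (i + 1)) (s (i + 1)) + P.l * dL1 (s i) (s (i + 1)) - WF O (σ.take i) (s i)) := by
  have htk : ∀ j, ∀ hj : j < σ.length, σ.take (j + 1) = σ.take j ++ [σ[j]] := by
    intro j hj; exact List.take_succ_eq_append_getElem hj
  have hl0 : 0 ≤ P.l := by have := P.hg2; unfold Par.l; linarith
  have hl1 : P.l ≤ 1 := by have := P.hg; unfold Par.l; linarith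
  have hSW : SW P (WF O (σ.take i)) (s i) := by
    intro u
    cases i with
    | zero =>
      rw [hr.1]
      simp only [List.take_zero, WF, d_self]
      have := d_nonneg O u
      positivity
    | succ j =>
      have h1 := hr.2 j (by omega) u
      have h2 := d_tri (s j) (s (j + 1)) u
      have h3 := mul_le_mul_of_nonneg_left h2 hl0
      linarith
  have hr0 : ∃ r0, ∀ x, ∃ t ∈ req r0, WF O (σ.take i) x = WF O (σ.take i) t + dL1 t x := by
    cases i with
    | zero =>
      refine ⟨O, fun x => ⟨O, req_self O, ?_⟩⟩
      simp only [List.take_zero, WF, d_self, zero_add]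
    | succ j =>
      have hj : j < σ.length := by omega
      refine ⟨σ[j], fun x => ?_⟩
      rw [htk j hj]
      obtain ⟨t, ht, e⟩ := WF_snoc_att σ[j] (σ.take j) O x
      refine ⟨t, ht, le_antisymm ?_ ?_⟩
      · have := WF_lip (σ.take j ++ [σ[j]]) O x t
        rwa [d_comm] at this
      · have := WF_snoc_le σ[j] (σ.take j) O t t ht
        rw [d_self] at this
        linarith
  obtain ⟨r0, hr0⟩ := hr0
  have hle : ∀ x, WF O (σ.take i) x ≤ WF O (σ.take (i + 1)) x := by
    intro x
    rw [htk i hi]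
    obtain ⟨t, ht, e⟩ := WF_snoc_att σ[i] (σ.take i) O x
    have := WF_lip (σ.take i) O x t
    rw [d_comm] at this
    linarith
  have heq : ∀ x ∈ req σ[i], WF O (σ.take (i + 1)) x = WF O (σ.take i) x := by
    intro x hx
    refine le_antisymm ?_ (hle x)
    have := WF_snoc_le σ[i] (σ.take i) O x x hx
    rw [d_self] at this
    rw [htk i hi]
    linarith
  refine ⟨r0, σ[i], ⟨WF_lip _ O, WF_lip _ O, hr0, hle, heq, ?_, hSW, ?_, ?_⟩⟩
  · intro x
    rw [htk i hi]
    exact WF_snoc_att σ[i] (σ.take i) O x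
  · have h1 := hSW (s (i + 1))
    have h2 := hle (s (i + 1))
    linarith
  · intro q hq
    have h1 := hr.2 i hi q
    rw [heq q hq] at h1
    linarith

lemma run_good {P : Par} {O : ℝ × ℝ} {σ : List (ℝ × ℝ)} {s : ℕ → ℝ × ℝ}
    (hr : IsWFARun P.l O σ s) (n : ℕ) : n ≤ σ.length → ∀ v, Good P (WF O (σ.take n)) v →
    P.κ0 / 2 * (P.l * ∑ i ∈ Finset.range n, dL1 (s i) (s (i + 1)) + WF O (σ.take n) (s n)) ≤ v := by
  induction n with
  | zero =>
    intro _ v hv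
    have := Good_nonneg (O := O) (fun s => by simp [WF]) hv
    simpa [hr.1, WF, d_self] using this
  | succ n ih =>
    intro hn v hv
    obtain ⟨r0, r, hs⟩ := run_step hr n (by omega)
    have := ih (by omega) _ (step_lemma hs hv)
    rw [Finset.sum_range_succ]
    linarith

/-- The generalized work function algorithm `WFA_λ` is constant competitive for the CNN
problem, for every `λ ∈ (0,1)`. -/
theorem wfa_constant_competitive_CNN (lam : ℝ) (h0 : 0 < lam) (h1 : lam < 1) :
    ∃ c : ℝ, 1 ≤ c ∧ ∀ (O : ℝ × ℝ) (σ : List (ℝ × ℝ)) (s : ℕ → ℝ × ℝ),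
      IsWFARun lam O σ s →
      ∑ i ∈ Finset.range σ.length, dL1 (s i) (s (i + 1)) ≤ c * OptC O σ := by
  obtain ⟨P, rfl⟩ := par_exists lam h0 h1
  have hg := P.hg
  have hκ : 0 < P.κ0 / 2 := by unfold Par.κ0; positivity
  have hC := P.C_pos
  refine ⟨max 1 ((2 * P.C + P.N) / (P.l * (P.κ0 / 2))), le_max_left _ _, ?_⟩
  intro O σ s hr
  set c := max 1 ((2 * P.C + P.N) / (P.l * (P.κ0 / 2))) with hc
  have hc1 : 1 ≤ c := le_max_left _ _
  have key : ∀ m, ∑ i ∈ Finset.range σ.length, dL1 (s i) (s (i + 1)) ≤ c * WF O σ m := by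
    intro m
    have hG : Good P (WF O (σ.take σ.length)) ((2 * P.C + P.N) * WF O σ m) := by
      refine Or.inl ⟨m, m, fun _ => m, ?_⟩
      rw [List.take_length]
      simp only [F0, Hf, d_self, mul_zero, sub_zero, min_self, Finset.sum_const, Finset.card_univ,
        Fintype.card_fin, nsmul_eq_mul]
      apply le_of_eq; ring
    have h2 := run_good hr σ.length le_rfl _ hG
    have h3 := WF_nonneg (σ.take σ.length) O (s σ.length)
    have h4 := mul_nonneg hκ.le h3
    have hpos : 0 < P.l * (P.κ0 / 2) := by positivity
    have h5 : ∑ i ∈ Finset.range σ.length, dL1 (s i) (s (i + 1)) ≤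
        (2 * P.C + P.N) / (P.l * (P.κ0 / 2)) * WF O σ m := by
      rw [div_mul_eq_mul_div, le_div_iff₀ hpos]
      linarith
    refine h5.trans ?_
    exact mul_le_mul_of_nonneg_right (le_max_right _ _) (WF_nonneg _ _ _)
  have hc0 : 0 < c := by linarith
  rw [← div_le_iff₀' hc0]
  refine le_csInf (Set.range_nonempty _) ?_
  rintro _ ⟨m, rfl⟩
  rw [div_le_iff₀' hc0]
  exact key m
end
end

section
/- For every λ ∈ (0,1) there exists a constant c ≥ 1, depending only on λ (and not on the metric spaces), such that for all metric spaces (X,d_X) and (Y,d_Y), every origin O ∈ X×Y, every finite request sequence ρ = r(p_1),…,r(p_n) of the generalized 2-server problem, and every run s_0 = O, s_1, …, s_n of the generalized work function algorithm WFA_λ on ρ, the total distance traveled satisfies Σ_{i=1}^n d(s_{i−1}, s_i) ≤ c · Opt_ρ. In other words, WFA_λ is constant competitive for the generalized 2-server problem. -/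
noncomputable section

/-- The sum metric on `X × Y` for the generalized 2-server problem. -/
def dSum {X Y : Type*} [MetricSpace X] [MetricSpace Y] (p q : X × Y) : ℝ :=
  dist p.1 q.1 + dist p.2 q.2

/-- The generalized 2-server request associated with `(x, y)`: `({x} × Y) ∪ (X × {y})`. -/
def gReq {X Y : Type*} (p : X × Y) : Set (X × Y) := {q | q.1 = p.1 ∨ q.2 = p.2}

/-- The work function of a finite request sequence (requests listed in order of arrival),
starting at origin `O`: the infimum over choices `tᵢ ∈ r(pᵢ)` of the length of the path
`O, t₁, …, tₙ, s`. -/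
noncomputable def gWF {X Y : Type*} [MetricSpace X] [MetricSpace Y] (O : X × Y) :
    List (X × Y) → (X × Y) → ℝ
  | [], s => dSum O s
  | p :: l, s => sInf ((fun t => dSum O t + gWF t l s) '' gReq p)

/-- The optimal (offline) cost of serving the request sequence `σ` from origin `O`. -/
noncomputable def gOpt {X Y : Type*} [MetricSpace X] [MetricSpace Y] (O : X × Y)
    (σ : List (X × Y)) : ℝ := sInf (Set.range (gWF O σ))

/-- `s 0 = O, s 1, …, s n` is a run of the generalized work function algorithm `WFA_λ` on `σ`:
each `s (i+1)` attains the minimum over `t` of `W_{r₁…r_{i+1}}(t) + λ·d(s i, t)`. -/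
def gIsWFARun {X Y : Type*} [MetricSpace X] [MetricSpace Y] (lam : ℝ) (O : X × Y)
    (σ : List (X × Y)) (s : ℕ → X × Y) : Prop :=
  s 0 = O ∧ ∀ i < σ.length, ∀ t : X × Y,
    gWF O (σ.take (i + 1)) (s (i + 1)) + lam * dSum (s i) (s (i + 1)) ≤
      gWF O (σ.take (i + 1)) t + lam * dSum (s i) t

section helpers

variable {X Y : Type*} [MetricSpace X] [MetricSpace Y]

lemma dS_nonneg (p q : X × Y) : 0 ≤ dSum p q := by unfold dSum; positivity

lemma dS_self (p : X × Y) : dSum p p = 0 := by simp [dSum]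

lemma dS_comm (p q : X × Y) : dSum p q = dSum q p := by
  simp [dSum, dist_comm]

lemma dS_tri (p q r : X × Y) : dSum p r ≤ dSum p q + dSum q r := by
  unfold dSum
  have h1 := dist_triangle p.1 q.1 r.1
  have h2 := dist_triangle p.2 q.2 r.2
  linarith

lemma gWF_nonneg (l : List (X × Y)) : ∀ (O s : X × Y), 0 ≤ gWF O l s := by
  induction l with
  | nil => intro O s; exact dS_nonneg _ _
  | cons p l ih =>
    intro O s
    simp only [gWF]
    apply Real.sInf_nonneg
    rintro _ ⟨t, _, rfl⟩
    have := dS_nonneg O t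
    have := ih t s
    simp only
    linarith

lemma gWF_bdd (O p : X × Y) (l : List (X × Y)) (s : X × Y) :
    BddBelow ((fun t => dSum O t + gWF t l s) '' gReq p) := by
  refine ⟨0, ?_⟩
  rintro _ ⟨t, _, rfl⟩
  have := dS_nonneg O t
  have := gWF_nonneg l t s
  simp only
  linarith

lemma gWF_cons_le (O p : X × Y) (l : List (X × Y)) (s t : X × Y) (ht : t ∈ gReq p) :
    gWF O (p :: l) s ≤ dSum O t + gWF t l s := by
  simp only [gWF]
  exact csInf_le (gWF_bdd O p l s) ⟨t, ht, rfl⟩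

lemma gWF_lip_cons (l : List (X × Y)) : ∀ (O O' s : X × Y),
    gWF O l s ≤ dSum O O' + gWF O' l s := by
  induction l with
  | nil => intro O O' s; exact dS_tri _ _ _
  | cons p l ih =>
    intro O O' s
    have h : gWF O (p :: l) s - dSum O O' ≤ gWF O' (p :: l) s := by
      conv_rhs => simp only [gWF]
      apply le_csInf
      · exact ⟨_, p, Or.inl rfl, rfl⟩
      · rintro _ ⟨t, ht, rfl⟩
        have h1 := gWF_cons_le O p l s t ht
        have h2 := dS_tri O O' t
        simp only
        linarith
    linarith

lemma gWF_cons_ex (O p : X × Y) (l : List (X × Y)) (s : X × Y) :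
    ∃ t ∈ gReq p, gWF O (p :: l) s = dSum O t + gWF t l s := by
  have key : min (dSum O (p.1, O.2) + gWF (p.1, O.2) l s)
      (dSum O (O.1, p.2) + gWF (O.1, p.2) l s) ≤ gWF O (p :: l) s := by
    conv_rhs => simp only [gWF]
    apply le_csInf
    · exact ⟨_, p, Or.inl rfl, rfl⟩
    · rintro _ ⟨⟨a, b⟩, ht, rfl⟩
      simp only [gReq, Set.mem_setOf_eq] at ht
      rcases ht with ht | ht
      · subst ht
        apply min_le_of_left_le
        have h := gWF_lip_cons l (p.1, O.2) (p.1, b) s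
        simp only [dSum, dist_self] at h ⊢
        linarith
      · subst ht
        apply min_le_of_right_le
        have h := gWF_lip_cons l (O.1, p.2) (a, p.2) s
        simp only [dSum, dist_self] at h ⊢
        linarith
  have m1 : ((p.1, O.2) : X × Y) ∈ gReq p := Or.inl rfl
  have m2 : ((O.1, p.2) : X × Y) ∈ gReq p := Or.inr rfl
  rcases min_le_iff.1 key with h | h
  · exact ⟨_, m1, le_antisymm (gWF_cons_le O p l s _ m1) h⟩
  · exact ⟨_, m2, le_antisymm (gWF_cons_le O p l s _ m2) h⟩

/-- `V` is obtained from `W` by the request at `r`. -/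
structure Att (W V : X × Y → ℝ) (r : X × Y) : Prop where
  le : ∀ q t, t ∈ gReq r → V q ≤ W t + dSum t q
  ex : ∀ q, ∃ t ∈ gReq r, V q = W t + dSum t q

lemma gWF_att (p : X × Y) (l : List (X × Y)) : ∀ (O : X × Y),
    Att (gWF O l) (gWF O (l ++ [p])) p := by
  induction l with
  | nil =>
    intro O
    refine ⟨fun q t ht => gWF_cons_le O p [] q t ht, fun q => gWF_cons_ex O p [] q⟩
  | cons a l ih =>
    intro O
    refine ⟨fun q t ht => ?_, fun q => ?_⟩
    · obtain ⟨u, hu, hu'⟩ := gWF_cons_ex O a l t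
      have h1 := gWF_cons_le O a (l ++ [p]) q u hu
      have h2 := (ih u).le q t ht
      rw [List.cons_append]
      linarith
    · obtain ⟨u, hu, hu'⟩ := gWF_cons_ex O a (l ++ [p]) q
      obtain ⟨t, ht, ht'⟩ := (ih u).ex q
      refine ⟨t, ht, le_antisymm ?_ ?_⟩
      · obtain ⟨u, hu, hu'⟩ := gWF_cons_ex O a l t
        have h1 := gWF_cons_le O a (l ++ [p]) q u hu
        have h2 := (ih u).le q t ht
        rw [List.cons_append]
        linarith
      · have := gWF_cons_le O a l t u hu
        rw [List.cons_append]
        linarith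

/-- 1-Lipschitz. -/
def Lp (W : X × Y → ℝ) : Prop := ∀ p q, W p ≤ W q + dSum p q

/-- `W` is supported on the request `r`. -/
def Sp (W : X × Y → ℝ) (r : X × Y) : Prop := ∀ q, ∃ t ∈ gReq r, W q = W t + dSum t q

lemma Att.lp {W V : X × Y → ℝ} {r : X × Y} (h : Att W V r) : Lp V := by
  intro p q
  obtain ⟨t, ht, h1⟩ := h.ex q
  have := h.le p t ht
  have := dS_tri t q p
  have := dS_comm p q
  linarith

lemma Att.ge {W V : X × Y → ℝ} {r : X × Y} (h : Att W V r) (hW : Lp W) (q : X × Y) :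
    W q ≤ V q := by
  obtain ⟨t, ht, h1⟩ := h.ex q
  have := hW q t
  have := dS_comm q t
  linarith

lemma Att.eq {W V : X × Y → ℝ} {r : X × Y} (h : Att W V r) (hW : Lp W) {q : X × Y}
    (hq : q ∈ gReq r) : V q = W q := by
  apply le_antisymm _ (h.ge hW q)
  have := h.le q q hq
  rw [dS_self] at this
  linarith

lemma Att.sp {W V : X × Y → ℝ} {r : X × Y} (h : Att W V r) (hW : Lp W) : Sp V r := by
  intro q
  obtain ⟨t, ht, h1⟩ := h.ex q
  exact ⟨t, ht, by rw [h1, h.eq hW ht]⟩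

lemma Att.raise1 {W V : X × Y → ℝ} {r : X × Y} (h : Att W V r) (hW : Lp W) (q : X × Y) :
    V q ≤ W q + 2 * dist q.1 r.1 := by
  have h1 := h.le q (r.1, q.2) (Or.inl rfl)
  have h2 := hW (r.1, q.2) q
  have h3 := dist_comm q.1 r.1
  simp only [dSum, dist_self] at h1 h2
  linarith

lemma Att.raise2 {W V : X × Y → ℝ} {r : X × Y} (h : Att W V r) (hW : Lp W) (q : X × Y) :
    V q ≤ W q + 2 * dist q.2 r.2 := by
  have h1 := h.le q (q.1, r.2) (Or.inr rfl)
  have h2 := hW (q.1, r.2) q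
  have h3 := dist_comm q.2 r.2
  simp only [dSum, dist_self] at h1 h2
  linarith

def C3 (b : ℝ) (W : X × Y → ℝ) (u w p : X × Y) (g : ℝ) : Prop :=
  W p ≤ W u + b * dSum p u + g ∧ W p ≤ W w + b * dSum p w + g

def CX (b K : ℝ) (W : X × Y → ℝ) (u w p : X × Y) (g : ℝ) : Prop :=
  ∀ y, W p ≤ W (u.1, y) + b * dSum p (u.1, y) + K * dist u.1 w.1 + g ∧
    W p ≤ W (w.1, y) + b * dSum p (w.1, y) + K * dist u.1 w.1 + g

def CY (b K : ℝ) (W : X × Y → ℝ) (u w p : X × Y) (g : ℝ) : Prop :=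
  ∀ x, W p ≤ W (x, u.2) + b * dSum p (x, u.2) + K * dist u.2 w.2 + g ∧
    W p ≤ W (x, w.2) + b * dSum p (x, w.2) + K * dist u.2 w.2 + g

def C4 (b K : ℝ) (W : X × Y → ℝ) (u w p : X × Y) (g : ℝ) : Prop :=
  C3 b W u w p g ∧ CX b K W u w p g ∧ CY b K W u w p g

lemma C3.symm {b : ℝ} {W : X × Y → ℝ} {u w p : X × Y} {g : ℝ} (h : C3 b W u w p g) :
    C3 b W w u p g := ⟨h.2, h.1⟩

lemma C4.symm {b K : ℝ} {W : X × Y → ℝ} {u w p : X × Y} {g : ℝ} (h : C4 b K W u w p g) :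
    C4 b K W w u p g := by
  obtain ⟨h1, h2, h3⟩ := h
  refine ⟨h1.symm, fun y => ?_, fun x => ?_⟩
  · rw [dist_comm w.1 u.1]; exact ⟨(h2 y).2, (h2 y).1⟩
  · rw [dist_comm w.2 u.2]; exact ⟨(h3 x).2, (h3 x).1⟩

lemma C3.mono {b : ℝ} {W : X × Y → ℝ} {u w p : X × Y} {g g' : ℝ} (h : C3 b W u w p g)
    (hg : g ≤ g') : C3 b W u w p g' := ⟨by linarith [h.1], by linarith [h.2]⟩

lemma CX.mono {b K : ℝ} {W : X × Y → ℝ} {u w p : X × Y} {g g' : ℝ} (h : CX b K W u w p g)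
    (hg : g ≤ g') : CX b K W u w p g' := fun y => ⟨by linarith [(h y).1], by linarith [(h y).2]⟩

lemma CY.mono {b K : ℝ} {W : X × Y → ℝ} {u w p : X × Y} {g g' : ℝ} (h : CY b K W u w p g)
    (hg : g ≤ g') : CY b K W u w p g' := fun y => ⟨by linarith [(h y).1], by linarith [(h y).2]⟩

lemma C4.mono {b K : ℝ} {W : X × Y → ℝ} {u w p : X × Y} {g g' : ℝ} (h : C4 b K W u w p g)
    (hg : g ≤ g') : C4 b K W u w p g' := ⟨h.1.mono hg, h.2.1.mono hg, h.2.2.mono hg⟩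

lemma C4.swap {b K : ℝ} {W : X × Y → ℝ} {u w p : X × Y} {g : ℝ} (h : C4 b K W u w p g) :
    C4 b K (fun q : Y × X => W q.swap) u.swap w.swap p.swap g := by
  obtain ⟨h1, h2, h3⟩ := h
  refine ⟨?_, fun y => ?_, fun x => ?_⟩
  · simpa [C3, dSum, add_comm] using h1
  · simpa [dSum, add_comm] using h3 y
  · simpa [dSum, add_comm] using h2 x

lemma C4.unswap {b K : ℝ} {W : X × Y → ℝ} {u w : X × Y} {p : Y × X} {g : ℝ}
    (h : C4 b K (fun q : Y × X => W q.swap) u.swap w.swap p g) :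
    C4 b K W u w p.swap g := by
  have := h.swap
  simpa using this

/-- moving an anchor -/
lemma C3.move {b : ℝ} {W : X × Y → ℝ} {u w p : X × Y} {g : ℝ} (h : C3 b W u w p g)
    (hW : Lp W) (hb : 0 ≤ b) (hb1 : b ≤ 1) (t : X × Y) : C3 b W t w p (g + 2 * dSum t u) := by
  have h0 := dS_nonneg t u
  refine ⟨?_, by linarith [h.2]⟩
  have h1 := hW u t
  have h2 := dS_comm u t
  have h3 := mul_le_mul_of_nonneg_left (dS_tri p t u) hb
  have h4 := mul_le_mul_of_nonneg_right hb1 h0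
  have := h.1
  nlinarith

lemma C4.move {b K : ℝ} {W : X × Y → ℝ} {u w p : X × Y} {g : ℝ} (h : C4 b K W u w p g)
    (hW : Lp W) (hb : 0 ≤ b) (hb1 : b ≤ 1) (hK : 0 ≤ K) (t : X × Y) :
    C4 b K W t w p (g + (2 + K) * dSum t u) := by
  have h0 := dS_nonneg t u
  obtain ⟨h1, h2, h3⟩ := h
  have hKd : 0 ≤ K * dSum t u := mul_nonneg hK h0
  have hd : dSum t u = dist t.1 u.1 + dist t.2 u.2 := rfl
  have e1 : 0 ≤ dist t.1 u.1 := dist_nonneg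
  have e2 : 0 ≤ dist t.2 u.2 := dist_nonneg
  refine ⟨(h1.move hW hb hb1 t).mono (by linarith), fun y => ?_, fun x => ?_⟩
  · have k1 : dist u.1 w.1 ≤ dSum t u + dist t.1 w.1 := by
      have := dist_triangle u.1 t.1 w.1
      have := dist_comm u.1 t.1
      linarith
    have k2 := mul_le_mul_of_nonneg_left k1 hK
    have k3 : dSum (u.1, y) (t.1, y) ≤ dSum t u := by
      have := dist_comm u.1 t.1
      simp only [dSum, dist_self]; linarith
    refine ⟨?_, ?_⟩
    · have a1 := (h2 y).1
      have a2 := hW (u.1, y) (t.1, y)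
      have a3 := mul_le_mul_of_nonneg_left (dS_tri p (t.1, y) (u.1, y)) hb
      have a4 := dS_comm (t.1, y) (u.1, y)
      have a5 := dS_nonneg (u.1, y) (t.1, y)
      have a6 := mul_le_mul_of_nonneg_right hb1 a5
      rw [a4] at a3
      nlinarith
    · have a1 := (h2 y).2
      nlinarith
  · have k1 : dist u.2 w.2 ≤ dSum t u + dist t.2 w.2 := by
      have := dist_triangle u.2 t.2 w.2
      have := dist_comm u.2 t.2
      linarith
    have k2 := mul_le_mul_of_nonneg_left k1 hK
    have k3 : dSum (x, u.2) (x, t.2) ≤ dSum t u := by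
      have := dist_comm u.2 t.2
      simp only [dSum, dist_self]; linarith
    refine ⟨?_, ?_⟩
    · have a1 := (h3 x).1
      have a2 := hW (x, u.2) (x, t.2)
      have a3 := mul_le_mul_of_nonneg_left (dS_tri p (x, t.2) (x, u.2)) hb
      have a4 := dS_comm (x, t.2) (x, u.2)
      have a5 := dS_nonneg (x, u.2) (x, t.2)
      have a6 := mul_le_mul_of_nonneg_right hb1 a5
      rw [a4] at a3
      nlinarith
    · have a1 := (h3 x).2
      nlinarith

/-- moving the point itself -/
lemma pt_move {b c g : ℝ} {W : X × Y → ℝ} {p t q : X × Y} (hb : 0 ≤ b)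
    (ht : W p = W t + dSum t p) (h : W p ≤ W q + b * dSum p q + c + g) :
    W t ≤ W q + b * dSum t q + c + (g - (1 - b) * dSum t p) := by
  have a3 := mul_le_mul_of_nonneg_left (dS_tri p t q) hb
  rw [dS_comm p t] at a3
  nlinarith

lemma C3.movep {b : ℝ} {W : X × Y → ℝ} {u w p t : X × Y} {g : ℝ} (h : C3 b W u w p g)
    (hb : 0 ≤ b) (ht : W p = W t + dSum t p) : C3 b W u w t (g - (1 - b) * dSum t p) := by
  have h1 := pt_move (c := 0) hb ht (by simpa using h.1)
  have h2 := pt_move (c := 0) hb ht (by simpa using h.2)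
  exact ⟨by linarith, by linarith⟩

lemma C4.movep {b K : ℝ} {W : X × Y → ℝ} {u w p t : X × Y} {g : ℝ} (h : C4 b K W u w p g)
    (hb : 0 ≤ b) (ht : W p = W t + dSum t p) : C4 b K W u w t (g - (1 - b) * dSum t p) :=
  ⟨h.1.movep hb ht, fun y => ⟨pt_move hb ht (h.2.1 y).1, pt_move hb ht (h.2.1 y).2⟩,
    fun x => ⟨pt_move hb ht (h.2.2 x).1, pt_move hb ht (h.2.2 x).2⟩⟩


lemma Att.raisek {W V : X × Y → ℝ} {r r0 : X × Y} {k : ℝ} (h : Att W V r) (hW : Lp W)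
    (h0 : Sp W r0) (k1 : dist r.1 r0.1 ≤ k) (k2 : dist r.2 r0.2 ≤ k) (q : X × Y) :
    V q ≤ W q + 2 * k := by
  obtain ⟨t, ht, e⟩ := h0 q
  rcases ht with ht | ht
  · have h1 := h.le q (r.1, t.2) (Or.inl rfl)
    have h2 := hW (r.1, t.2) t
    have h3 := dS_tri (r.1, t.2) t q
    have h4 : dSum (r.1, t.2) t ≤ k := by simpa [dSum, ht] using k1
    linarith
  · have h1 := h.le q (t.1, r.2) (Or.inr rfl)
    have h2 := hW (t.1, r.2) t
    have h3 := dS_tri (t.1, r.2) t q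
    have h4 : dSum (t.1, r.2) t ≤ k := by simpa [dSum, ht] using k2
    linarith

set_option maxHeartbeats 1000000 in
lemma lemN3 {W V : X × Y → ℝ} {r r0 u w p : X × Y} {e b K C0 A B ρ δ γ : ℝ}
    (hW : Lp W) (h0 : Sp W r0) (hV : Att W V r)
    (hb : 0 ≤ b) (hb1 : b = 1 - 2 * e) (he : 0 < e) (he1 : e ≤ 1 / 3) (hC0 : 1 ≤ C0)
    (hKC : 4 * C0 ≤ e * K) (hA0 : 0 ≤ A) (hB0 : 0 ≤ B) (hA : A ≤ ρ / 32) (hB : B ≤ 1 / 32)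
    (hδ : 0 ≤ δ)
    (hu : u.1 = r.1) (hw : w.2 = r.2) (hp : p ∈ gReq r) (h4 : C4 b K V u w p γ)
    (hirr : ∀ p γ', C3 b W u w p γ' → ∀ q,
      W p ≤ W q + b * dSum p q + C0 * (dist u.1 w.1 + dist u.2 w.2) + γ')
    (hrel : K * dist u.2 w.2 < C0 * (dist u.1 w.1 + dist u.2 w.2))
    (hnear : ∀ l, 0 ≤ l → ∀ p', C4 b K W u w p' (γ + l) →
      (∃ t ∈ gReq r0, dSum t u ≤ A * δ + B * l) ∧ (∃ t ∈ gReq r0, dSum t w ≤ A * δ + B * l))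
    (ε : ℝ) (hε : 0 < ε) : ∃ p', C4 b K W u w p' (γ + ρ * δ + ε) := by
  set h := dist u.2 w.2 with hh
  set H := dist u.1 w.1 with hH
  have h_nn : 0 ≤ h := dist_nonneg
  have H_nn : 0 ≤ H := dist_nonneg
  have hρ : 0 ≤ ρ := by linarith
  have hρδ : 0 ≤ ρ * δ := mul_nonneg hρ hδ
  have hK : 12 * C0 ≤ K := by nlinarith
  have hhH : h ≤ H := by
    by_contra hc
    push Not at hc
    nlinarith
  have hXirr : C0 * (H + h) ≤ K * H := by nlinarith
  have um : u ∈ gReq r := Or.inl hu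
  have wm : w ∈ gReq r := Or.inr hw
  have ep := hV.eq hW hp
  have eu := hV.eq hW um
  have ew := hV.eq hW wm
  have F3 : C3 b W u w p γ := by
    have := h4.1
    unfold C3 at this
    rw [ep, eu, ew] at this
    exact this
  have FX : CX b K W u w p γ := fun y =>
    ⟨by linarith [hirr p γ F3 (u.1, y)], by linarith [hirr p γ F3 (w.1, y)]⟩
  have FYw : ∀ x, W p ≤ W (x, w.2) + b * dSum p (x, w.2) + K * h + γ := by
    intro x
    have := (h4.2.2 x).2
    rwa [ep, hV.eq hW (q := (x, w.2)) (Or.inr hw)] at this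
  have FYu : ∀ x, W p ≤ V (x, u.2) + b * dSum p (x, u.2) + K * h + γ := by
    intro x
    have := (h4.2.2 x).1
    rwa [ep] at this
  have R : ∀ l, 0 ≤ l → (∀ x, V (x, u.2) ≤ W (x, u.2) + l) → C4 b K W u w p (γ + l) := by
    intro l hl hx
    refine ⟨F3.mono (by linarith), FX.mono (by linarith), fun x => ⟨?_, ?_⟩⟩
    · linarith [FYu x, hx x]
    · linarith [FYw x]
  have raise_h : ∀ x, V (x, u.2) ≤ W (x, u.2) + 2 * h := by
    intro x
    have := hV.raise2 hW (x, u.2)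
    rw [hh, hw]; exact this
  by_cases hγ : -(K * h) ≤ γ
  · -- case A
    by_cases hc : C4 b K W u w p γ
    · exact ⟨p, hc.mono (by linarith)⟩
    set f : X → ℝ := fun x => W p - W (x, u.2) - b * dSum p (x, u.2) with hf
    have hex : ∃ x, K * h + γ < f x := by
      by_contra hne
      push Not at hne
      apply hc
      refine ⟨F3, FX, fun x => ⟨?_, FYw x⟩⟩
      have := hne x
      simp only [hf] at this
      linarith
    have hbdd : BddAbove (Set.range f) := by
      refine ⟨K * h + γ + 2 * h, ?_⟩
      rintro _ ⟨x, rfl⟩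
      simp only [hf]
      linarith [FYu x, raise_h x]
    obtain ⟨x', hx'⟩ := hex
    have hE : f x' ≤ iSup f := le_ciSup hbdd x'
    have : Nonempty X := ⟨x'⟩
    have hlt : max (iSup f - ε) (K * h + γ) < iSup f := max_lt (by linarith) (by linarith)
    obtain ⟨x1, hx1⟩ := exists_lt_of_lt_ciSup hlt
    have g1 : iSup f - ε < f x1 := lt_of_le_of_lt (le_max_left _ _) hx1
    have g2 : K * h + γ < f x1 := lt_of_le_of_lt (le_max_right _ _) hx1
    have g3 : f x1 = W p - W (x1, u.2) - b * dSum p (x1, u.2) := rfl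
    have tr : ∀ z cz, W p ≤ W z + b * dSum p z + cz + γ →
        W (x1, u.2) ≤ W z + b * dSum (x1, u.2) z + cz + (-(K * h) + ε) := by
      intro z cz hz
      have := mul_le_mul_of_nonneg_left (dS_tri p (x1, u.2) z) hb
      linarith
    refine ⟨(x1, u.2), C4.mono (g := -(K * h) + ε) ⟨⟨?_, ?_⟩, fun y => ⟨?_, ?_⟩, fun x => ⟨?_, ?_⟩⟩
      (by linarith)⟩
    · have := tr u 0 (by linarith [F3.1]); linarith
    · have := tr w 0 (by linarith [F3.2]); linarith
    · exact tr _ _ (FX y).1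
    · exact tr _ _ (FX y).2
    · have t1 := le_ciSup hbdd x
      have t2 : f x = W p - W (x, u.2) - b * dSum p (x, u.2) := rfl
      have := mul_le_mul_of_nonneg_left (dS_tri p (x1, u.2) (x, u.2)) hb
      linarith
    · exact tr _ _ (FYw x)
  · push Not at hγ
    by_cases hsm : 2 * h ≤ ρ * δ
    · exact ⟨p, (R (2 * h) (by linarith) raise_h).mono (by linarith)⟩
    push Not at hsm
    set k := max (dist r.1 r0.1) (dist r.2 r0.2) with hk
    have k1 : dist r.1 r0.1 ≤ k := le_max_left _ _
    have k2 : dist r.2 r0.2 ≤ k := le_max_right _ _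
    have k0 : 0 ≤ k := le_trans dist_nonneg k1
    have raise_k := fun x => hV.raisek hW h0 k1 k2 (x, u.2)
    set l := 2 * min h k with hl
    have l0 : 0 ≤ l := by have := le_min h_nn k0; linarith
    have lh : l ≤ 2 * h := by have := min_le_left h k; linarith
    have lk : l ≤ 2 * k := by have := min_le_right h k; linarith
    have C4l : C4 b K W u w p (γ + l) := by
      apply R l l0
      intro x
      rcases min_cases h k with ⟨hm, _⟩ | ⟨hm, _⟩
      · rw [hl, hm]; exact raise_h x
      · rw [hl, hm]; exact raise_k x
    obtain ⟨⟨tu, htu, du⟩, ⟨tw, htw, dw⟩⟩ := hnear l l0 p C4l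
    set τ := A * δ + B * l with hτ
    have hAδ : A * δ ≤ ρ / 32 * δ := mul_le_mul_of_nonneg_right hA hδ
    have hBl : B * l ≤ 1 / 32 * l := mul_le_mul_of_nonneg_right hB l0
    have τh : τ ≤ h / 8 := by linarith
    have hpos : 0 < h := by linarith
    have nu : dist r.1 r0.1 ≤ τ ∨ dist u.2 r0.2 ≤ τ := by
      have a1 : 0 ≤ dist tu.1 u.1 := dist_nonneg
      have a2 : 0 ≤ dist tu.2 u.2 := dist_nonneg
      unfold dSum at du
      rcases htu with ht | ht
      · left; rw [dist_comm, ← hu, ← ht]; linarith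
      · right; rw [dist_comm, ← ht]; linarith
    have nw : dist w.1 r0.1 ≤ τ ∨ dist r.2 r0.2 ≤ τ := by
      have a1 : 0 ≤ dist tw.1 w.1 := dist_nonneg
      have a2 : 0 ≤ dist tw.2 w.2 := dist_nonneg
      unfold dSum at dw
      rcases htw with ht | ht
      · left; rw [dist_comm, ← ht]; linarith
      · right; rw [dist_comm, ← hw, ← ht]; linarith
    have hHle : H ≤ dist r.1 r0.1 + dist w.1 r0.1 := by
      rw [hH, hu]; exact dist_triangle_right _ _ _
    have hhle : h ≤ dist u.2 r0.2 + dist r.2 r0.2 := by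
      rw [hh, hw]; exact dist_triangle_right _ _ _
    rcases nw with nw | nw
    · rcases nu with nu | nu
      · exfalso; linarith
      · -- main case
        rcases hp with hp | hp
        swap
        · exfalso
          have := FYw p.1
          rw [hw, ← hp] at this
          have e2 : dSum p (p.1, p.2) = 0 := dS_self p
          rw [e2] at this
          linarith
        obtain ⟨t, ht, et⟩ := h0 p
        by_cases hd : l ≤ 2 * e * dSum t p
        · refine ⟨t, (C4l.movep hb et).mono ?_⟩
          rw [hb1]; linarith
        push Not at hd
        exfalso
        have ded : dSum t p = dist t.1 p.1 + dist t.2 p.2 := rfl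
        have a1 : 0 ≤ dist t.1 p.1 := dist_nonneg
        have a2 : 0 ≤ dist t.2 p.2 := dist_nonneg
        have hd' : e * dSum t p < h := by linarith
        rcases ht with ht | ht
        · have q1 : dist r.1 r0.1 ≤ dSum t p := by
            rw [dist_comm, ← ht, ← hp]; linarith
          have q2' : e * H ≤ e * (dSum t p + h / 8) :=
            mul_le_mul_of_nonneg_left (by linarith) he.le
          have q2'' : e * h ≤ 1 / 3 * h := mul_le_mul_of_nonneg_right he1 h_nn
          have q2 : e * H < 2 * h := by linarith
          have q3 : e * (K * h) < e * (C0 * (H + h)) := mul_lt_mul_of_pos_left hrel he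
          have q4 : 4 * C0 * h ≤ e * K * h := mul_le_mul_of_nonneg_right hKC h_nn
          have q5 : C0 * (e * H) ≤ C0 * (2 * h) :=
            mul_le_mul_of_nonneg_left q2.le (by linarith)
          have q6 : C0 * h * e ≤ C0 * h * (1 / 3) :=
            mul_le_mul_of_nonneg_left he1 (by positivity)
          have q7 : 0 < C0 * h := by positivity
          linarith
        · have q1 : dSum p u ≤ dSum t p + τ := by
            have z := dist_triangle p.2 r0.2 u.2
            have z1 : dist p.2 r0.2 = dist t.2 p.2 := by rw [ht, dist_comm]
            have z2 := dist_comm r0.2 u.2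
            have z3 : dSum p u = dist p.2 u.2 := by simp [dSum, hp, hu]
            linarith
          have q2 := hW u p
          rw [dS_comm u p] at q2
          have q3 := F3.1
          have q4 : b * dSum p u ≤ 1 * dSum p u :=
            mul_le_mul_of_nonneg_right (by linarith) (dS_nonneg _ _)
          have q5 : K * h < 2 * (dSum t p + h / 8) := by linarith
          have q6 : e * (K * h) < e * (2 * (dSum t p + h / 8)) := mul_lt_mul_of_pos_left q5 he
          have q7 : 4 * C0 * h ≤ e * K * h := mul_le_mul_of_nonneg_right hKC h_nn
          have q8 : 1 * h ≤ C0 * h := mul_le_mul_of_nonneg_right hC0 h_nn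
          have q9 : e * h ≤ 1 / 3 * h := mul_le_mul_of_nonneg_right he1 h_nn
          linarith
    · rcases nu with nu | nu
      · have kt : k ≤ τ := max_le nu nw
        exact ⟨p, (R (2 * k) (by linarith) raise_k).mono (by linarith)⟩
      · exfalso; linarith

lemma dS_swap (p q : X × Y) : dSum p.swap q.swap = dSum p q := by
  simp [dSum, add_comm]

lemma dS_swap' (p : X × Y) (q : Y × X) : dSum p q.swap = dSum p.swap q := by
  simp [dSum, add_comm]

lemma dS_swap'' (p : X × Y) (q : Y × X) : dSum q.swap p = dSum q p.swap := by
  simp [dSum, add_comm]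

lemma req_swap_s1 {p r : X × Y} (h : p ∈ gReq r) : p.swap ∈ gReq r.swap := Or.symm h

lemma Lp.swap {W : X × Y → ℝ} (h : Lp W) : Lp (fun q : Y × X => W q.swap) := by
  intro p q
  have := h p.swap q.swap
  rwa [dS_swap] at this

lemma Sp.swap {W : X × Y → ℝ} {r : X × Y} (h : Sp W r) :
    Sp (fun q : Y × X => W q.swap) r.swap := by
  intro q
  obtain ⟨t, ht, e⟩ := h q.swap
  refine ⟨t.swap, req_swap_s1 ht, ?_⟩
  simp only [Prod.swap_swap]
  rw [e, dS_swap']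

lemma Att.swap {W V : X × Y → ℝ} {r : X × Y} (h : Att W V r) :
    Att (fun q : Y × X => W q.swap) (fun q : Y × X => V q.swap) r.swap := by
  refine ⟨fun q t ht => ?_, fun q => ?_⟩
  · have := h.le q.swap t.swap (Or.symm ht)
    rwa [dS_swap] at this
  · obtain ⟨t, ht, e⟩ := h.ex q.swap
    refine ⟨t.swap, req_swap_s1 ht, ?_⟩
    simp only [Prod.swap_swap]
    rw [e, dS_swap']

lemma C3.unswap {b : ℝ} {W : X × Y → ℝ} {u w : X × Y} {p : Y × X} {g : ℝ}
    (h : C3 b (fun q : Y × X => W q.swap) u.swap w.swap p g) :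
    C3 b W u w p.swap g := by
  unfold C3 at h ⊢
  simp only [Prod.swap_swap] at h
  rwa [dS_swap'', dS_swap'']

lemma lemN5 {W V : X × Y → ℝ} {r r0 u w p : X × Y} {e b K C0 A B ρ δ γ : ℝ}
    (hW : Lp W) (h0 : Sp W r0) (hV : Att W V r)
    (hb : 0 ≤ b) (hb1 : b = 1 - 2 * e) (he : 0 < e) (he1 : e ≤ 1 / 3) (hC0 : 1 ≤ C0)
    (hKC : 4 * C0 ≤ e * K) (hA0 : 0 ≤ A) (hB0 : 0 ≤ B) (hA : A ≤ ρ / 32) (hB : B ≤ 1 / 32)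
    (hδ : 0 ≤ δ)
    (hu : u.1 = r.1) (hw : w.2 = r.2) (hp : p ∈ gReq r) (h4 : C4 b K V u w p γ)
    (hirr : ∀ p γ', C3 b W u w p γ' → ∀ q,
      W p ≤ W q + b * dSum p q + C0 * dSum u w + γ')
    (hnear : ∀ l, 0 ≤ l → ∀ p', C4 b K W u w p' (γ + l) →
      (∃ t ∈ gReq r0, dSum t u ≤ A * δ + B * l) ∧ (∃ t ∈ gReq r0, dSum t w ≤ A * δ + B * l))
    (ε : ℝ) (hε : 0 < ε) : ∃ p', C4 b K W u w p' (γ + ρ * δ + ε) := by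
  by_cases c1 : K * dist u.2 w.2 < C0 * dSum u w
  · exact lemN3 hW h0 hV hb hb1 he he1 hC0 hKC hA0 hB0 hA hB hδ hu hw hp h4 hirr c1 hnear ε hε
  by_cases c2 : K * dist u.1 w.1 < C0 * dSum u w
  · have := lemN3 (u := w.swap) (w := u.swap) (p := p.swap) (γ := γ) hW.swap h0.swap hV.swap
      hb hb1 he he1 hC0 hKC hA0 hB0 hA hB hδ hw hu (req_swap_s1 hp) h4.symm.swap ?_ ?_ ?_ ε hε
    · obtain ⟨p', hp'⟩ := this
      exact ⟨p'.swap, hp'.unswap.symm⟩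
    · intro p γ' h3 q
      have := hirr _ _ h3.unswap.symm q.swap
      rw [dS_swap] at this
      have e1 : dSum u w = dist w.swap.1 u.swap.1 + dist w.swap.2 u.swap.2 := by
        simp [dSum, add_comm, dist_comm]
      rw [e1] at this
      exact this
    · have e1 : dSum u w = dist w.swap.1 u.swap.1 + dist w.swap.2 u.swap.2 := by
        simp [dSum, add_comm, dist_comm]
      rw [← e1]
      simpa [dist_comm] using c2
    · intro l hl p' hp'
      obtain ⟨⟨t1, m1, d1⟩, ⟨t2, m2, d2⟩⟩ := hnear l hl p'.swap hp'.unswap.symm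
      exact ⟨⟨t2.swap, req_swap_s1 m2, by rwa [dS_swap]⟩, ⟨t1.swap, req_swap_s1 m1, by rwa [dS_swap]⟩⟩
  · push Not at c1 c2
    have ep := hV.eq hW hp
    have eu := hV.eq hW (q := u) (Or.inl hu)
    have ew := hV.eq hW (q := w) (Or.inr hw)
    have F3 : C3 b W u w p γ := by
      have := h4.1
      unfold C3 at this
      rw [ep, eu, ew] at this
      exact this
    have hρδ : 0 ≤ ρ * δ := mul_nonneg (by linarith) hδ
    refine ⟨p, C4.mono (g := γ) ⟨F3, fun y => ⟨?_, ?_⟩, fun x => ⟨?_, ?_⟩⟩ (by linarith)⟩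
    · linarith [hirr p γ F3 (u.1, y)]
    · linarith [hirr p γ F3 (w.1, y)]
    · linarith [hirr p γ F3 (x, u.2)]
    · linarith [hirr p γ F3 (x, w.2)]

lemma lemN {W V : X × Y → ℝ} {r r0 u w p : X × Y} {e b K C0 A B ρ δ γ : ℝ}
    (hW : Lp W) (h0 : Sp W r0) (hV : Att W V r)
    (hb : 0 ≤ b) (hb1 : b = 1 - 2 * e) (he : 0 < e) (he1 : e ≤ 1 / 3) (hC0 : 1 ≤ C0)
    (hKC : 4 * C0 ≤ e * K) (hA0 : 0 ≤ A) (hB0 : 0 ≤ B) (hA : A ≤ ρ / 32) (hB : B ≤ 1 / 32)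
    (hδ : 0 ≤ δ)
    (hu : u ∈ gReq r) (hw : w ∈ gReq r) (hp : p ∈ gReq r) (h4 : C4 b K V u w p γ)
    (hirr : ∀ p γ', C3 b W u w p γ' → ∀ q,
      W p ≤ W q + b * dSum p q + C0 * dSum u w + γ')
    (hnear : ∀ l, 0 ≤ l → ∀ p', C4 b K W u w p' (γ + l) →
      (∃ t ∈ gReq r0, dSum t u ≤ A * δ + B * l) ∧ (∃ t ∈ gReq r0, dSum t w ≤ A * δ + B * l))
    (ε : ℝ) (hε : 0 < ε) : ∃ p', C4 b K W u w p' (γ + ρ * δ + ε) := by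
  have ep := hV.eq hW hp
  have eu := hV.eq hW hu
  have ew := hV.eq hW hw
  have F3 : C3 b W u w p γ := by
    have := h4.1
    unfold C3 at this
    rw [ep, eu, ew] at this
    exact this
  have hρδ : 0 ≤ ρ * δ := mul_nonneg (by linarith) hδ
  have hKC' : C0 ≤ K := by nlinarith
  have dn := dS_nonneg u w
  have hKd : C0 * dSum u w ≤ K * dSum u w := mul_le_mul_of_nonneg_right hKC' dn
  rcases hu with hu | hu <;> rcases hw with hw | hw
  · have hd : dSum u w = dist u.2 w.2 := by simp [dSum, hu, hw]
    refine ⟨p, C4.mono (g := γ) ⟨F3, fun y => ?_, fun x => ⟨?_, ?_⟩⟩ (by linarith)⟩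
    · have := h4.2.1 y
      rwa [ep, hV.eq hW (q := (u.1, y)) (Or.inl hu),
        hV.eq hW (q := (w.1, y)) (Or.inl hw)] at this
    · rw [← hd]; linarith [hirr p γ F3 (x, u.2)]
    · rw [← hd]; linarith [hirr p γ F3 (x, w.2)]
  · exact lemN5 hW h0 hV hb hb1 he he1 hC0 hKC hA0 hB0 hA hB hδ hu hw hp h4 hirr hnear ε hε
  · have := lemN5 hW h0 hV hb hb1 he he1 hC0 hKC hA0 hB0 hA hB hδ hw hu hp h4.symm
      (fun p g h => by rw [dS_comm w u]; exact hirr p g h.symm)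
      (fun l hl p' h => (hnear l hl p' h.symm).symm) ε hε
    obtain ⟨p', hp'⟩ := this
    exact ⟨p', hp'.symm⟩
  · have hd : dSum u w = dist u.1 w.1 := by simp [dSum, hu, hw]
    refine ⟨p, C4.mono (g := γ) ⟨F3, fun y => ⟨?_, ?_⟩, fun x => ?_⟩ (by linarith)⟩
    · rw [← hd]; linarith [hirr p γ F3 (u.1, y)]
    · rw [← hd]; linarith [hirr p γ F3 (w.1, y)]
    · have := h4.2.2 x
      rwa [ep, hV.eq hW (q := (x, u.2)) (Or.inr hu),
        hV.eq hW (q := (x, w.2)) (Or.inr hw)] at this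

lemma raise_dist {W V : X × Y → ℝ} {r : X × Y} (hW : Lp W) (hV : Att W V r) (s q : X × Y)
    (k : ℝ) (hq : V q ≤ W q + k) : V s - W s ≤ 2 * dSum s q + k := by
  have h1 := hV.lp s q
  have h2 := hW q s
  rw [dS_comm q s] at h2
  linarith

set_option maxHeartbeats 1000000 in
lemma lemArm {W V : X × Y → ℝ} {r r0 p1 p2 p4 s : X × Y}
    {lam e b K C0 θ θ4 η δ γ g0 : ℝ}
    (hW : Lp W) (h0 : Sp W r0) (hV : Att W V r)
    (hb : 0 ≤ b) (hb1 : b = 1 - 2 * e) (hlam : b = lam + e) (he : 0 < e)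
    (hC0 : 0 ≤ C0) (hKC : 2 * C0 ≤ K) (hK8 : 8 ≤ K)
    (hθ0 : 0 ≤ θ) (hθ4 : η + 4 * θ ≤ 2 * e * θ4) (hη : η ≤ e / 8) (hθe : 128 * θ ≤ e)
    (hθ2 : θ ≤ 1 / 16) (hθ42 : θ4 ≤ 1 / 4) (hfin : 6 * θ + 2 * θ4 + 4 * (K * θ) ≤ e / 8)
    (hδ : 0 < δ) (hδs : δ = V s - W s) (hs : s ∈ gReq r0)
    (hsup : ∀ t, W s ≤ W t + lam * dSum s t)
    (hx : dist r.1 r0.1 ≤ θ * δ)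
    (hx1 : dist p1.1 r.1 ≤ 2 * (θ * δ)) (hx2 : dist p2.1 r.1 ≤ 2 * (θ * δ))
    (m1 : p1 ∈ gReq r) (m2 : p2 ∈ gReq r) (m4 : p4 ∈ gReq r)
    (hd12 : e * δ / 16 ≤ dSum p1 p2)
    (h4 : C4 b K V p1 p2 p4 γ)
    (hirr : ∀ p γ', C3 b W p1 p2 p γ' → ∀ q,
      W p ≤ W q + b * dSum p q + C0 * dSum p1 p2 + γ')
    (hB : ∀ p g, C4 b K W p1 p2 p g → g0 ≤ g) (hγ : γ < g0 + η * δ) : False := by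
  have e1 := hV.eq hW m1
  have e2 := hV.eq hW m2
  have e4 := hV.eq hW m4
  have hθδ : 0 ≤ θ * δ := mul_nonneg hθ0 hδ.le
  have n1 : θ * δ ≤ 1 / 16 * δ := mul_le_mul_of_nonneg_right hθ2 hδ.le
  have n2 : θ4 * δ ≤ 1 / 4 * δ := mul_le_mul_of_nonneg_right hθ42 hδ.le
  have n3 : 128 * θ * δ ≤ e * δ := mul_le_mul_of_nonneg_right hθe hδ.le
  have n4 : η * δ ≤ e / 8 * δ := mul_le_mul_of_nonneg_right hη hδ.le
  have n5 : (6 * θ + 2 * θ4 + 4 * (K * θ)) * δ ≤ e / 8 * δ :=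
    mul_le_mul_of_nonneg_right hfin hδ.le
  have heδ : 0 < e * δ := mul_pos he hδ
  have hdY : dSum p1 p2 / 2 ≤ dist p1.2 p2.2 := by
    have z : dSum p1 p2 = dist p1.1 p2.1 + dist p1.2 p2.2 := rfl
    have z2 := dist_triangle_right p1.1 p2.1 r.1
    linarith
  have dn := dS_nonneg p1 p2
  have hKd : C0 * dSum p1 p2 ≤ K * dist p1.2 p2.2 := by
    have z1 := mul_le_mul_of_nonneg_right hKC dn
    have z2 := mul_le_mul_of_nonneg_left hdY (by linarith : 0 ≤ K)
    linarith
  have hKd2 : e * δ / 4 ≤ K * dist p1.2 p2.2 := by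
    have z1 := mul_le_mul_of_nonneg_right hK8 dn
    have z2 := mul_le_mul_of_nonneg_left hdY (by linarith : 0 ≤ K)
    linarith
  have hKx : 0 ≤ K * dist p1.1 p2.1 := mul_nonneg (by linarith) dist_nonneg
  have r1 : ∀ y, V (p1.1, y) ≤ W (p1.1, y) + 4 * (θ * δ) := by
    intro y
    have := hV.raise1 hW (p1.1, y)
    simp only at this
    linarith
  have r2 : ∀ y, V (p2.1, y) ≤ W (p2.1, y) + 4 * (θ * δ) := by
    intro y
    have := hV.raise1 hW (p2.1, y)
    simp only at this
    linarith
  have far : ∀ q, V q ≤ W q + 4 * (θ * δ) → W s ≤ W q + b * dSum s q - e * δ / 4 := by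
    intro q hq
    have z1 := raise_dist hW hV s q _ hq
    have z2 : δ / 4 ≤ dSum s q := by linarith
    have z3 := mul_le_mul_of_nonneg_left z2 he.le
    have z4 := hsup q
    rw [hlam]
    linarith
  -- step 1
  have hsC : C4 b K W p1 p2 s (-(e * δ / 4)) := by
    refine ⟨⟨?_, ?_⟩, fun y => ⟨?_, ?_⟩, fun x => ⟨?_, ?_⟩⟩
    · linarith [far p1 (by linarith)]
    · linarith [far p2 (by linarith)]
    · linarith [far _ (r1 y)]
    · linarith [far _ (r2 y)]
    · have z1 := hsup (x, p1.2)
      have z2 := mul_nonneg he.le (dS_nonneg s (x, p1.2))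
      have z3 : b * dSum s (x, p1.2) = lam * dSum s (x, p1.2) + e * dSum s (x, p1.2) := by
        rw [hlam]; ring
      linarith
    · have z1 := hsup (x, p2.2)
      have z2 := mul_nonneg he.le (dS_nonneg s (x, p2.2))
      have z3 : b * dSum s (x, p2.2) = lam * dSum s (x, p2.2) + e * dSum s (x, p2.2) := by
        rw [hlam]; ring
      linarith
  have g0le := hB _ _ hsC
  -- step 3
  have F3 : C3 b W p1 p2 p4 γ := by
    have := h4.1
    unfold C3 at this
    rw [e4, e1, e2] at this
    exact this
  have h4W : C4 b K W p1 p2 p4 (γ + 4 * (θ * δ)) := by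
    refine ⟨F3.mono (by linarith), fun y => ?_, fun x => ⟨?_, ?_⟩⟩
    · have z := h4.2.1 y
      rw [e4] at z
      exact ⟨by linarith [z.1, r1 y], by linarith [z.2, r2 y]⟩
    · linarith [hirr p4 γ F3 (x, p1.2)]
    · linarith [hirr p4 γ F3 (x, p2.2)]
  obtain ⟨t4, mt4, et4⟩ := h0 p4
  have hb4 := hB _ _ (h4W.movep hb et4)
  have hd4 : dSum t4 p4 < θ4 * δ := by
    have z1 : (η + 4 * θ) * δ ≤ 2 * e * θ4 * δ := mul_le_mul_of_nonneg_right hθ4 hδ.le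
    rw [hb1] at hb4
    have z2 : e * dSum t4 p4 < e * (θ4 * δ) := by linarith
    exact lt_of_mul_lt_mul_left z2 he.le
  have dd : dSum t4 p4 = dist t4.1 p4.1 + dist t4.2 p4.2 := rfl
  have dd1 : 0 ≤ dist t4.1 p4.1 := dist_nonneg
  have dd2 : 0 ≤ dist t4.2 p4.2 := dist_nonneg
  have near4 : dist p4.1 r.1 ≤ (θ + θ4) * δ := by
    rcases m4 with m4 | m4
    · rw [m4, dist_self]; linarith
    · rcases mt4 with mt | mt
      · rw [mt] at dd
        have z1 := dist_triangle_right p4.1 r.1 r0.1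
        have z2 := dist_comm p4.1 r0.1
        have z3 : 0 ≤ dist r0.1 p4.1 := dist_nonneg
        linarith
      · exfalso
        rw [mt, m4] at dd
        have z2 := dist_comm r.2 r0.2
        rcases hs with hs | hs
        · have := hV.raise1 hW s
          rw [hs, dist_comm] at this
          linarith
        · have := hV.raise2 hW s
          rw [hs] at this
          linarith
  have c1 := (h4.2.1 p4.2).1
  have c2 := hV.lp (p1.1, p4.2) p4
  rw [dS_comm (p1.1, p4.2) p4] at c2
  have c3 : b * dSum p4 (p1.1, p4.2) ≤ 1 * dSum p4 (p1.1, p4.2) :=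
    mul_le_mul_of_nonneg_right (by linarith) (dS_nonneg _ _)
  have c4 : dSum p4 (p1.1, p4.2) ≤ (θ + θ4) * δ + 2 * (θ * δ) := by
    have z := dist_triangle_right p4.1 p1.1 r.1
    simp only [dSum, dist_self, add_zero]
    linarith
  have c5 : K * dist p1.1 p2.1 ≤ K * (4 * (θ * δ)) := by
    apply mul_le_mul_of_nonneg_left _ (by linarith)
    have z2 := dist_triangle_right p1.1 p2.1 r.1
    linarith
  linarith

lemma near_type {r r0 p t : X × Y} {D : ℝ} (hp : p ∈ gReq r) (ht : t ∈ gReq r0)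
    (hd : dSum t p ≤ D) :
    (p.1 = r.1 ∧ dist r.1 r0.1 ≤ D) ∨ (p.1 = r.1 ∧ dist p.2 r0.2 ≤ D) ∨
    (p.2 = r.2 ∧ dist p.1 r0.1 ≤ D) ∨ (p.2 = r.2 ∧ dist r.2 r0.2 ≤ D) := by
  have dd1 : 0 ≤ dist t.1 p.1 := dist_nonneg
  have dd2 : 0 ≤ dist t.2 p.2 := dist_nonneg
  have dd : dSum t p = dist t.1 p.1 + dist t.2 p.2 := rfl
  rcases hp with hp | hp <;> rcases ht with ht | ht
  · left; refine ⟨hp, ?_⟩; rw [dist_comm, ← ht, ← hp]; linarith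
  · right; left; refine ⟨hp, ?_⟩; rw [dist_comm, ← ht]; linarith
  · right; right; left; refine ⟨hp, ?_⟩; rw [dist_comm, ← ht]; linarith
  · right; right; right; refine ⟨hp, ?_⟩; rw [dist_comm, ← ht, ← hp]; linarith

lemma close_a {p q r r0 : X × Y} {D : ℝ} (h1 : p.1 = r.1) (h2 : q.1 = r.1)
    (h3 : dist p.2 r0.2 ≤ D) (h4 : dist q.2 r0.2 ≤ D) : dSum p q ≤ 2 * D := by
  have := dist_triangle_right p.2 q.2 r0.2
  simp only [dSum, h1, h2, dist_self]
  linarith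

lemma close_b {p q r r0 : X × Y} {D : ℝ} (h1 : p.2 = r.2) (h2 : q.2 = r.2)
    (h3 : dist p.1 r0.1 ≤ D) (h4 : dist q.1 r0.1 ≤ D) : dSum p q ≤ 2 * D := by
  have := dist_triangle_right p.1 q.1 r0.1
  simp only [dSum, h1, h2, dist_self]
  linarith

lemma near_arm1 {r r0 p t : X × Y} {D : ℝ} (hp : p ∈ gReq r) (ht : t ∈ gReq r0)
    (hd : dSum t p ≤ D) (hx : dist r.1 r0.1 ≤ D) (hy : ¬ dist r.2 r0.2 ≤ D) :
    dist p.1 r.1 ≤ 2 * D := by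
  have hD : 0 ≤ D := le_trans dist_nonneg hx
  rcases near_type hp ht hd with h | h | h | h
  · rw [h.1, dist_self]; linarith
  · rw [h.1, dist_self]; linarith
  · have := dist_triangle_right p.1 r.1 r0.1
    linarith [h.2]
  · exact absurd h.2 hy

lemma near_arm2 {r r0 p t : X × Y} {D : ℝ} (hp : p ∈ gReq r) (ht : t ∈ gReq r0)
    (hd : dSum t p ≤ D) (hx : dist r.2 r0.2 ≤ D) (hy : ¬ dist r.1 r0.1 ≤ D) :
    dist p.2 r.2 ≤ 2 * D := by
  have hD : 0 ≤ D := le_trans dist_nonneg hx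
  rcases near_type hp ht hd with h | h | h | h
  · exact absurd h.2 hy
  · have := dist_triangle_right p.2 r.2 r0.2
    linarith [h.2]
  · rw [h.1, dist_self]; linarith
  · rw [h.1, dist_self]; linarith

lemma near_far {r r0 p t : X × Y} {D : ℝ} (hp : p ∈ gReq r) (ht : t ∈ gReq r0)
    (hd : dSum t p ≤ D) (hx : ¬ dist r.2 r0.2 ≤ D) (hy : ¬ dist r.1 r0.1 ≤ D) :
    (p.1 = r.1 ∧ dist p.2 r0.2 ≤ D) ∨ (p.2 = r.2 ∧ dist p.1 r0.1 ≤ D) := by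
  rcases near_type hp ht hd with h | h | h | h
  · exact absurd h.2 hy
  · exact Or.inl h
  · exact Or.inr h
  · exact absurd h.2 hx

lemma trip {r r0 p1 p2 p3 t1 t2 t3 : X × Y} {D : ℝ}
    (m1 : p1 ∈ gReq r) (m2 : p2 ∈ gReq r) (m3 : p3 ∈ gReq r)
    (n1 : t1 ∈ gReq r0) (n2 : t2 ∈ gReq r0) (n3 : t3 ∈ gReq r0)
    (d1 : dSum t1 p1 ≤ D) (d2 : dSum t2 p2 ≤ D) (d3 : dSum t3 p3 ≤ D)
    (d12 : 2 * D < dSum p1 p2) (d31 : 2 * D < dSum p3 p1) (d32 : 2 * D < dSum p3 p2)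
    (nb : ¬ (dist r.1 r0.1 ≤ D ∧ dist r.2 r0.2 ≤ D)) :
    (dist r.1 r0.1 ≤ D ∧ dist p1.1 r.1 ≤ 2 * D ∧ dist p2.1 r.1 ≤ 2 * D) ∨
    (dist r.2 r0.2 ≤ D ∧ dist p1.2 r.2 ≤ 2 * D ∧ dist p2.2 r.2 ≤ 2 * D) := by
  by_cases hx : dist r.1 r0.1 ≤ D
  · have hy : ¬ dist r.2 r0.2 ≤ D := fun h => nb ⟨hx, h⟩
    exact Or.inl ⟨hx, near_arm1 m1 n1 d1 hx hy, near_arm1 m2 n2 d2 hx hy⟩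
  by_cases hy : dist r.2 r0.2 ≤ D
  · exact Or.inr ⟨hy, near_arm2 m1 n1 d1 hy hx, near_arm2 m2 n2 d2 hy hx⟩
  exfalso
  rcases near_far m1 n1 d1 hy hx with h1 | h1 <;> rcases near_far m2 n2 d2 hy hx with h2 | h2 <;>
    rcases near_far m3 n3 d3 hy hx with h3 | h3
  · linarith [close_a h1.1 h2.1 h1.2 h2.2]
  · linarith [close_a h1.1 h2.1 h1.2 h2.2]
  · linarith [close_a h3.1 h1.1 h3.2 h1.2]
  · linarith [close_b h3.1 h2.1 h3.2 h2.2]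
  · linarith [close_a h3.1 h2.1 h3.2 h2.2]
  · linarith [close_b h3.1 h1.1 h3.2 h1.2]
  · linarith [close_b h1.1 h2.1 h1.2 h2.2]
  · linarith [close_b h1.1 h2.1 h1.2 h2.2]

/-- The invariant. -/
def SInv (b b2 K a2 a3 a4 : ℝ) (W : X × Y → ℝ) (v : ℝ) : Prop :=
  ∀ p1 p2 p3 p4 g3 g4, C3 b W p1 p2 p3 g3 → C4 b K W p1 p2 p4 g4 →
    v ≤ (1 - a2) * W p1 + a2 * W p2 - a2 * (b2 * dSum p1 p2) + a3 * g3 + a4 * g4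

/-- The constraints on the constants. -/
structure Par_s1 (lam e b b2 C0 K a2 a3 a4 ρ c η θ θ4 A B : ℝ) : Prop where
  he : 0 < e
  he1 : e ≤ 1 / 3
  hb : 0 ≤ b
  hb1 : b = 1 - 2 * e
  hlam : b = lam + e
  hlam0 : 0 ≤ lam
  hb2 : b2 = 1 - e
  heC : e * C0 = 16
  hC0 : 1 ≤ C0
  hKC : 4 * C0 ≤ e * K
  hKC2 : 2 * C0 ≤ K
  hK8 : 8 ≤ K
  ha2 : 0 < a2
  ha3 : 0 < a3
  ha4 : 0 < a4
  hc : 0 < c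
  hρ : 0 < ρ
  h34 : a3 + a4 ≤ a2 * e / 4
  h2c : 2 * c ≤ a2 * e / 4
  ha21 : a2 ≤ 1 / 8
  n1 : 1 / 2 ≤ 1 - a2 - a2 * b2 - 2 * a3 - (2 + K) * a4
  n2 : a2 * e / 2 ≤ a2 * e - 2 * a3 - (2 + K) * a4
  hcA : c ≤ a2 * e / 2 * A
  h4B : a4 ≤ a2 * e / 2 * B
  hA0 : 0 ≤ A
  hB0 : 0 ≤ B
  hA : A ≤ ρ / 32
  hB : B ≤ 1 / 32
  hθa : c + 2 * ρ * a4 ≤ 2 * e * a3 * θ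
  hθb : c + 2 * ρ * a4 ≤ a2 * e / 2 * θ
  hη0 : c = a4 * η
  hθ0 : 0 ≤ θ
  hθ4 : η + 4 * θ ≤ 2 * e * θ4
  hη : η ≤ e / 8
  hθe : 128 * θ ≤ e
  hθ2 : θ ≤ 1 / 16
  hθ42 : θ4 ≤ 1 / 4
  hfin : 6 * θ + 2 * θ4 + 4 * (K * θ) ≤ e / 8
  hinit : 0 ≤ 1 - 2 * a2 - 2 * a3 - 2 * a4

lemma sup_C4 {lam b K : ℝ} {W : X × Y → ℝ} {s : X × Y} (hl : lam ≤ b) (hK : 0 ≤ K)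
    (hsup : ∀ t, W s ≤ W t + lam * dSum s t) (u w : X × Y) : C4 b K W u w s 0 := by
  have h : ∀ q k, 0 ≤ k → W s ≤ W q + b * dSum s q + k + 0 := by
    intro q k hk
    have := mul_le_mul_of_nonneg_right hl (dS_nonneg s q)
    have := hsup q
    linarith
  have k1 : 0 ≤ K * dist u.1 w.1 := mul_nonneg hK dist_nonneg
  have k2 : 0 ≤ K * dist u.2 w.2 := mul_nonneg hK dist_nonneg
  refine ⟨⟨?_, ?_⟩, fun y => ⟨h _ _ k1, h _ _ k1⟩, fun y => ⟨h _ _ k2, h _ _ k2⟩⟩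
  · have := h u 0 le_rfl; linarith
  · have := h w 0 le_rfl; linarith

lemma sup_mem {lam : ℝ} {W : X × Y → ℝ} {s r0 : X × Y} (hl : lam < 1) (h0 : Sp W r0)
    (hsup : ∀ t, W s ≤ W t + lam * dSum s t) : s ∈ gReq r0 := by
  obtain ⟨t, ht, e⟩ := h0 s
  have h1 := hsup t
  rw [dS_comm s t] at h1
  have h2 := dS_nonneg t s
  have h3 : dSum t s = 0 := by nlinarith
  have a1 : 0 ≤ dist t.1 s.1 := dist_nonneg
  have a2 : 0 ≤ dist t.2 s.2 := dist_nonneg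
  unfold dSum at h3
  have e1 : t.1 = s.1 := dist_eq_zero.1 (by linarith)
  have e2 : t.2 = s.2 := dist_eq_zero.1 (by linarith)
  rwa [← (Prod.ext e1 e2 : t = s)]

section core

variable {lam e b b2 C0 K a2 a3 a4 ρ c η θ θ4 A B v : ℝ}

lemma near1 (P : Par_s1 lam e b b2 C0 K a2 a3 a4 ρ c η θ θ4 A B) {W : X × Y → ℝ}
    (hW : Lp W) (hI : SInv b b2 K a2 a3 a4 W v) {p1 p2 p3 p4 t : X × Y} {g3 g4 E : ℝ}
    (h3 : C3 b W p1 p2 p3 g3) (h4 : C4 b K W p1 p2 p4 g4)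
    (hF : (1 - a2) * W p1 + a2 * W p2 - a2 * (b2 * dSum p1 p2) + a3 * g3 + a4 * g4 ≤ v + E)
    (ht : W p1 = W t + dSum t p1) : dSum t p1 / 2 ≤ E := by
  have hb1' : b ≤ 1 := by linarith [P.hb1, P.he]
  have hI' := hI _ _ _ _ _ _ (h3.move hW P.hb hb1' t)
    (h4.move hW P.hb hb1' (by linarith [P.hK8]) t)
  have d0 := dS_nonneg t p1
  have hab : 0 ≤ a2 * b2 := mul_nonneg P.ha2.le (by linarith [P.hb2, P.he1])
  have q1 : a2 * b2 * dSum p1 p2 ≤ a2 * b2 * (dSum t p1 + dSum t p2) := by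
    apply mul_le_mul_of_nonneg_left _ hab
    have := dS_tri p1 t p2
    rw [dS_comm p1 t] at this
    exact this
  have q2 := mul_le_mul_of_nonneg_right P.n1 d0
  have ht' : W t = W p1 - dSum t p1 := by linarith
  rw [ht'] at hI'
  linarith

lemma near2 (P : Par_s1 lam e b b2 C0 K a2 a3 a4 ρ c η θ θ4 A B) {W : X × Y → ℝ}
    (hW : Lp W) (hI : SInv b b2 K a2 a3 a4 W v) {p1 p2 p3 p4 t : X × Y} {g3 g4 E : ℝ}
    (h3 : C3 b W p1 p2 p3 g3) (h4 : C4 b K W p1 p2 p4 g4)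
    (hF : (1 - a2) * W p1 + a2 * W p2 - a2 * (b2 * dSum p1 p2) + a3 * g3 + a4 * g4 ≤ v + E)
    (ht : W p2 = W t + dSum t p2) : a2 * e / 2 * dSum t p2 ≤ E := by
  have hb1' : b ≤ 1 := by linarith [P.hb1, P.he]
  have hI' := hI _ _ _ _ _ _ (h3.symm.move hW P.hb hb1' t).symm
    (h4.symm.move hW P.hb hb1' (by linarith [P.hK8]) t).symm
  have d0 := dS_nonneg t p2
  have hab : 0 ≤ a2 * b2 := mul_nonneg P.ha2.le (by linarith [P.hb2, P.he1])
  have q1 : a2 * b2 * dSum p1 p2 ≤ a2 * b2 * (dSum p1 t + dSum t p2) :=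
    mul_le_mul_of_nonneg_left (dS_tri p1 t p2) hab
  have q2 := mul_le_mul_of_nonneg_right P.n2 d0
  have ht' : W t = W p2 - dSum t p2 := by linarith
  rw [ht'] at hI'
  have hb2 := P.hb2
  subst hb2
  linarith

lemma near3 (P : Par_s1 lam e b b2 C0 K a2 a3 a4 ρ c η θ θ4 A B) {W : X × Y → ℝ}
    (hI : SInv b b2 K a2 a3 a4 W v) {p1 p2 p3 p4 t : X × Y} {g3 g4 E : ℝ}
    (h3 : C3 b W p1 p2 p3 g3) (h4 : C4 b K W p1 p2 p4 g4)
    (hF : (1 - a2) * W p1 + a2 * W p2 - a2 * (b2 * dSum p1 p2) + a3 * g3 + a4 * g4 ≤ v + E)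
    (ht : W p3 = W t + dSum t p3) : 2 * e * a3 * dSum t p3 ≤ E := by
  have hI' := hI _ _ _ _ _ _ (h3.movep P.hb ht) h4
  rw [P.hb1] at hI'
  linarith

lemma near4 (P : Par_s1 lam e b b2 C0 K a2 a3 a4 ρ c η θ θ4 A B) {W : X × Y → ℝ}
    (hI : SInv b b2 K a2 a3 a4 W v) {p1 p2 p3 p4 t : X × Y} {g3 g4 E : ℝ}
    (h3 : C3 b W p1 p2 p3 g3) (h4 : C4 b K W p1 p2 p4 g4)
    (hF : (1 - a2) * W p1 + a2 * W p2 - a2 * (b2 * dSum p1 p2) + a3 * g3 + a4 * g4 ≤ v + E)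
    (ht : W p4 = W t + dSum t p4) : 2 * e * a4 * dSum t p4 ≤ E := by
  have hI' := hI _ _ _ _ _ _ h3 (h4.movep P.hb ht)
  rw [P.hb1] at hI'
  linarith

set_option maxHeartbeats 2000000 in
lemma lemCore (P : Par_s1 lam e b b2 C0 K a2 a3 a4 ρ c η θ θ4 A B) {W V : X × Y → ℝ}
    {r r0 s p1 p2 p3 p4 : X × Y} {g3 γ : ℝ}
    (hW : Lp W) (h0 : Sp W r0) (hV : Att W V r)
    (hsup : ∀ t, W s ≤ W t + lam * dSum s t) (hI : SInv b b2 K a2 a3 a4 W v)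
    (m1 : p1 ∈ gReq r) (m2 : p2 ∈ gReq r) (m3 : p3 ∈ gReq r) (m4 : p4 ∈ gReq r)
    (h3V : C3 b V p1 p2 p3 g3) (h4 : C4 b K V p1 p2 p4 γ) :
    v + c * (V s - W s) ≤
      (1 - a2) * V p1 + a2 * V p2 - a2 * (b2 * dSum p1 p2) + a3 * g3 + a4 * γ := by
  by_contra H
  push Not at H
  have e1 := hV.eq hW m1
  have e2 := hV.eq hW m2
  have e3 := hV.eq hW m3
  have h3 : C3 b W p1 p2 p3 g3 := by
    unfold C3 at h3V
    rw [e3, e1, e2] at h3V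
    exact h3V
  have F4 : C3 b W p1 p2 p4 γ := by
    have := h4.1
    unfold C3 at this
    rw [hV.eq hW m4, e1, e2] at this
    exact this
  rw [e1, e2] at H
  have he := P.he
  have hb1 := P.hb1
  have hlb : lam ≤ b := by linarith [P.hlam]
  have hb1' : b ≤ 1 := by linarith
  have hK0 : 0 ≤ K := by linarith [P.hK8]
  have hs4 := fun u w => sup_C4 hlb hK0 hsup u w
  have hsm : s ∈ gReq r0 := sup_mem (by linarith [P.hlam]) h0 hsup
  obtain ⟨δ, hδd⟩ : ∃ δ, δ = V s - W s := ⟨_, rfl⟩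
  have hδ : 0 ≤ δ := by linarith [hV.ge hW s]
  rw [← hδd] at H
  obtain ⟨D, hD⟩ : ∃ D, D = dSum p1 p2 := ⟨_, rfl⟩
  have D0 : 0 ≤ D := hD ▸ dS_nonneg _ _
  rw [← hD] at H
  have ha2e : 0 < a2 * e := mul_pos P.ha2 he
  have hb2 := P.hb2
  -- L1
  have L1 : ∀ q, W q ≤ W p1 + b * dSum q p1 → a2 * e * dSum p1 q ≤ W p1 - v := by
    intro q hq
    have h := hI p1 q s s 0 0 (hs4 _ _).1 (hs4 _ _)
    have h2 := mul_le_mul_of_nonneg_left hq P.ha2.le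
    rw [dS_comm q p1, hb1] at h2
    rw [hb2] at h
    linarith
  have Δ0 : 0 ≤ W p1 - v := by
    have := L1 p1 (by rw [dS_self]; linarith)
    rwa [dS_self, mul_zero] at this
  obtain ⟨G, hG⟩ : ∃ G, a2 * e * G = 2 * (W p1 - v) :=
    ⟨2 * (W p1 - v) / (a2 * e), mul_div_cancel₀ _ ha2e.ne'⟩
  have G0 : 0 ≤ G := by
    by_contra hc
    push Not at hc
    have := mul_neg_of_pos_of_neg ha2e hc
    linarith
  have gG : ∀ p g, C3 b W p1 p2 p g → -G ≤ g := by
    intro p g h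
    by_contra hc
    push Not at hc
    have h1 := h.1
    have h2 := L1 p (by linarith)
    have h3 := hW p1 p
    rw [dS_comm p1 p] at h3 h2
    have h4 : b * dSum p p1 ≤ 1 * dSum p p1 := mul_le_mul_of_nonneg_right hb1' (dS_nonneg _ _)
    have h6 : G < 2 * dSum p p1 := by linarith
    have h7 := mul_lt_mul_of_pos_left h6 ha2e
    linarith
  have hg3 := gG _ _ h3
  have hγG := gG _ _ F4
  have hΔ : W p1 - v ≤ 4 * (a2 * D) + 2 * (c * δ) := by
    have q1 := hW p1 p2
    rw [← hD] at q1
    have q2 := mul_le_mul_of_nonneg_left q1 P.ha2.le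
    have q3 := mul_le_mul_of_nonneg_left hg3 P.ha3.le
    have q4 := mul_le_mul_of_nonneg_left hγG P.ha4.le
    have q5 := mul_le_mul_of_nonneg_right P.h34 G0
    have q6 : a2 * (b2 * D) ≤ a2 * D := by
      apply mul_le_mul_of_nonneg_left _ P.ha2.le
      have : b2 * D ≤ 1 * D := mul_le_mul_of_nonneg_right (by linarith) D0
      linarith
    linarith
  have farV : ∀ q ∈ gReq r, δ / 2 ≤ dSum s q := by
    intro q hq
    have := raise_dist hW hV s q 0 (by linarith [hV.eq hW hq])
    linarith
  have h2cδ : 2 * c * δ ≤ a2 * e / 4 * δ := mul_le_mul_of_nonneg_right P.h2c hδ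
  have hDδ : e * δ / 16 ≤ D := by
    have q1 := L1 s (by
      have := (hs4 p1 p1).1.1
      linarith)
    have q2 := farV p1 m1
    rw [dS_comm p1 s] at q1
    have q3 := mul_le_mul_of_nonneg_left q2 ha2e.le
    have q4 : a2 * (e * δ / 16) ≤ a2 * D := by linarith
    exact le_of_mul_le_mul_left q4 P.ha2
  have L1' : ∀ q, W q ≤ W p1 + b * dSum q p1 → 2 * dSum p1 q ≤ C0 * D := by
    intro q hq
    have q1 := L1 q hq
    have q2 := mul_le_mul_of_nonneg_left hDδ P.ha2.le
    have q3 : a2 * (e * dSum p1 q) ≤ a2 * (8 * D) := by linarith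
    have q4 := le_of_mul_le_mul_left q3 P.ha2
    have q5 : e * (2 * dSum p1 q) ≤ e * (C0 * D) := by
      have : e * (C0 * D) = 16 * D := by rw [← mul_assoc, P.heC]
      linarith
    exact le_of_mul_le_mul_left q5 he
  have CD0 : 0 ≤ C0 * D := mul_nonneg (by linarith [P.hC0]) D0
  have L2 : ∀ q, W p1 + b * dSum q p1 ≤ W q + C0 * D := by
    intro q
    by_cases hq : W q ≤ W p1 + b * dSum q p1
    · have q1 := L1' q hq
      have q2 := hW p1 q
      have h4 : b * dSum p1 q ≤ 1 * dSum p1 q := mul_le_mul_of_nonneg_right hb1' (dS_nonneg _ _)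
      rw [dS_comm q p1]
      linarith
    · linarith
  have hirr : ∀ p γ', C3 b W p1 p2 p γ' → ∀ q,
      W p ≤ W q + b * dSum p q + C0 * dSum p1 p2 + γ' := by
    intro p γ' h q
    have q1 := L2 q
    have q2 := h.1
    have q3 := mul_le_mul_of_nonneg_left (dS_tri p q p1) P.hb
    rw [← hD]
    linarith
  have hnear : ∀ l, 0 ≤ l → ∀ p', C4 b K W p1 p2 p' (γ + l) →
      (∃ t ∈ gReq r0, dSum t p1 ≤ A * δ + B * l) ∧
      (∃ t ∈ gReq r0, dSum t p2 ≤ A * δ + B * l) := by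
    intro l hl p' h'
    obtain ⟨t1, n1, d1⟩ := h0 p1
    obtain ⟨t2, n2, d2⟩ := h0 p2
    have hF : (1 - a2) * W p1 + a2 * W p2 - a2 * (b2 * dSum p1 p2) + a3 * g3 + a4 * (γ + l) ≤
        v + (c * δ + a4 * l) := by rw [← hD]; linarith
    have z1 := near1 P hW hI h3 h' hF d1
    have z2 := near2 P hW hI h3 h' hF d2
    have z3 := mul_le_mul_of_nonneg_right P.hcA hδ
    have z4 := mul_le_mul_of_nonneg_right P.h4B hl
    have z5 : a2 * e / 2 ≤ 1 / 2 := by nlinarith [P.ha21, P.he1]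
    have z6 := mul_le_mul_of_nonneg_right z5 (dS_nonneg t1 p1)
    refine ⟨⟨t1, n1, ?_⟩, ⟨t2, n2, ?_⟩⟩
    · have : a2 * e / 2 * dSum t1 p1 ≤ a2 * e / 2 * (A * δ + B * l) := by linarith
      exact le_of_mul_le_mul_left this (by linarith)
    · have : a2 * e / 2 * dSum t2 p2 ≤ a2 * e / 2 * (A * δ + B * l) := by linarith
      exact le_of_mul_le_mul_left this (by linarith)
  have hN := lemN hW h0 hV P.hb P.hb1 P.he P.he1 P.hC0 P.hKC P.hA0 P.hB0 P.hA P.hB hδ m1 m2 m4 h4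
    hirr hnear
  rcases hδ.eq_or_lt with hδ0 | hδ0
  · -- δ = 0
    obtain ⟨ε, hε0, hε⟩ : ∃ ε, 0 < ε ∧ a4 * ε < v -
        ((1 - a2) * W p1 + a2 * W p2 - a2 * (b2 * D) + a3 * g3 + a4 * γ) := by
      rw [← hδ0, mul_zero, add_zero] at H
      refine ⟨(v - ((1 - a2) * W p1 + a2 * W p2 - a2 * (b2 * D) + a3 * g3 + a4 * γ)) / (2 * a4),
        div_pos (by linarith) (by linarith [P.ha4]), ?_⟩
      have ha4 := P.ha4
      field_simp
      linarith
    obtain ⟨p', hp'⟩ := hN ε hε0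
    have := hI _ _ _ _ _ _ h3 hp'
    rw [← hδ0, mul_zero, add_zero, ← hD] at this
    linarith
  · obtain ⟨p', hp'⟩ := hN (ρ * δ) (mul_pos P.hρ hδ0)
    have hE : (c + 2 * ρ * a4) * δ = c * δ + a4 * (ρ * δ + ρ * δ) := by ring
    have hF : (1 - a2) * W p1 + a2 * W p2 - a2 * (b2 * dSum p1 p2) + a3 * g3 +
        a4 * (γ + ρ * δ + ρ * δ) ≤ v + (c + 2 * ρ * a4) * δ := by rw [← hD, hE]; linarith
    obtain ⟨t1, n1, d1⟩ := h0 p1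
    obtain ⟨t2, n2, d2⟩ := h0 p2
    obtain ⟨t3, n3, d3⟩ := h0 p3
    have z1 := near1 P hW hI h3 hp' hF d1
    have z2 := near2 P hW hI h3 hp' hF d2
    have z3 := near3 P hI h3 hp' hF d3
    have za := mul_le_mul_of_nonneg_right P.hθa hδ
    have zb := mul_le_mul_of_nonneg_right P.hθb hδ
    have z5 : a2 * e / 2 ≤ 1 / 2 := by nlinarith [P.ha21, P.he1]
    have z6 := mul_le_mul_of_nonneg_right z5 (dS_nonneg t1 p1)
    have D1 : dSum t1 p1 ≤ θ * δ := by
      have : a2 * e / 2 * dSum t1 p1 ≤ a2 * e / 2 * (θ * δ) := by linarith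
      exact le_of_mul_le_mul_left this (by linarith)
    have D2 : dSum t2 p2 ≤ θ * δ := by
      have : a2 * e / 2 * dSum t2 p2 ≤ a2 * e / 2 * (θ * δ) := by linarith
      exact le_of_mul_le_mul_left this (by linarith)
    have he3 : 0 < 2 * e * a3 := mul_pos (by linarith) P.ha3
    have D3 : dSum t3 p3 ≤ θ * δ := by
      have : 2 * e * a3 * dSum t3 p3 ≤ 2 * e * a3 * (θ * δ) := by linarith
      exact le_of_mul_le_mul_left this he3
    have hs3 : C3 b W p1 p2 s (-(e * δ / 2)) := by
      have key : ∀ q ∈ gReq r, W s ≤ W q + b * dSum s q + -(e * δ / 2) := by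
        intro q hq
        have y1 := mul_le_mul_of_nonneg_left (farV q hq) he.le
        have y2 := hsup q
        rw [P.hlam]
        linarith
      exact ⟨key _ m1, key _ m2⟩
    have hIs := hI _ _ _ _ _ _ hs3 hp'
    rw [← hD] at hIs
    have heδ : 0 < e * δ := mul_pos he hδ0
    have nθ : θ * δ ≤ 1 / 16 * δ := mul_le_mul_of_nonneg_right P.hθ2 hδ
    have nθe : 128 * θ * δ ≤ e * δ := mul_le_mul_of_nonneg_right P.hθe hδ
    have hθδ : 0 ≤ θ * δ := mul_nonneg P.hθ0 hδ
    have g3le : g3 ≤ -(e * δ / 4) := by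
      have y1 : a3 * g3 ≤ a3 * (-(e * δ / 2) + 2 * e * (θ * δ)) := by linarith
      have y2 := le_of_mul_le_mul_left y1 P.ha3
      have y3 := mul_le_mul_of_nonneg_left nθ he.le
      linarith
    have D31 : e * δ / 8 ≤ dSum p3 p1 := by
      have y1 := h3.1
      have y2 := hW p1 p3
      rw [dS_comm p1 p3] at y2
      have y3 : b * dSum p3 p1 ≤ 1 * dSum p3 p1 := mul_le_mul_of_nonneg_right hb1' (dS_nonneg _ _)
      linarith
    have D32 : e * δ / 8 ≤ dSum p3 p2 := by
      have y1 := h3.2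
      have y2 := hW p2 p3
      rw [dS_comm p2 p3] at y2
      have y3 : b * dSum p3 p2 ≤ 1 * dSum p3 p2 := mul_le_mul_of_nonneg_right hb1' (dS_nonneg _ _)
      linarith
    have nb : ¬ (dist r.1 r0.1 ≤ θ * δ ∧ dist r.2 r0.2 ≤ θ * δ) := by
      rintro ⟨y1, y2⟩
      rcases hsm with hs | hs
      · have := hV.raise1 hW s
        rw [hs, dist_comm] at this
        linarith
      · have := hV.raise2 hW s
        rw [hs, dist_comm] at this
        linarith
    have T := trip m1 m2 m3 n1 n2 n3 D1 D2 D3 (by linarith) (by linarith) (by linarith) nb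
    obtain ⟨g0, hg0⟩ : ∃ g0, a4 * g0 = v -
        ((1 - a2) * W p1 + a2 * W p2 - a2 * (b2 * D) + a3 * g3) :=
      ⟨(v - ((1 - a2) * W p1 + a2 * W p2 - a2 * (b2 * D) + a3 * g3)) / a4, by
        have ha4 := P.ha4
        field_simp⟩
    have hB' : ∀ p g, C4 b K W p1 p2 p g → g0 ≤ g := by
      intro p g h
      have y := hI _ _ _ _ _ _ h3 h
      rw [← hD] at y
      have y1 : a4 * g0 ≤ a4 * g := by linarith
      exact le_of_mul_le_mul_left y1 P.ha4
    have hγ' : γ < g0 + η * δ := by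
      rw [P.hη0] at H
      have y1 : a4 * γ < a4 * (g0 + η * δ) := by linarith
      exact lt_of_mul_lt_mul_left y1 P.ha4.le
    rcases T with ⟨y1, y2, y3⟩ | ⟨y1, y2, y3⟩
    · exact lemArm hW h0 hV P.hb P.hb1 P.hlam he (by linarith [P.hC0]) P.hKC2 P.hK8 P.hθ0 P.hθ4
        P.hη P.hθe P.hθ2 P.hθ42 P.hfin hδ0 hδd hsm hsup y1 y2 y3 m1 m2 m4 (hD ▸ hDδ) h4 hirr
        hB' hγ'
    · refine lemArm (s := s.swap) (p1 := p1.swap) (p2 := p2.swap) (p4 := p4.swap)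
        hW.swap h0.swap hV.swap P.hb P.hb1 P.hlam he
        (by linarith [P.hC0]) P.hKC2 P.hK8 P.hθ0 P.hθ4
        P.hη P.hθe P.hθ2 P.hθ42 P.hfin hδ0 hδd (req_swap_s1 hsm) ?_ y1 y2 y3 (req_swap_s1 m1)
        (req_swap_s1 m2) (req_swap_s1 m4) ?_ h4.swap ?_ ?_ hγ'
      · intro t
        have := hsup t.swap
        rwa [dS_swap'] at this
      · rw [dS_swap, ← hD]; exact hDδ
      · intro p γ' h q
        have := hirr _ _ h.unswap q.swap
        rw [dS_swap] at this
        rw [dS_swap]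
        exact this
      · intro p g h
        exact hB' _ _ h.unswap

end core

section wrap

variable {lam e b b2 C0 K a2 a3 a4 ρ c η θ θ4 A B v : ℝ}

lemma lemStep (P : Par_s1 lam e b b2 C0 K a2 a3 a4 ρ c η θ θ4 A B) {W V : X × Y → ℝ}
    {r r0 s : X × Y} (hW : Lp W) (h0 : Sp W r0) (hV : Att W V r)
    (hsup : ∀ t, W s ≤ W t + lam * dSum s t) (hI : SInv b b2 K a2 a3 a4 W v) :
    SInv b b2 K a2 a3 a4 V (v + c * (V s - W s)) := by
  intro p1 p2 p3 p4 g3 g4 h3 h4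
  have hb1' : b ≤ 1 := by linarith [P.hb1, P.he]
  have hK0 : 0 ≤ K := by linarith [P.hK8]
  have hL := hV.lp
  have hS := hV.sp hW
  obtain ⟨t1, m1, d1⟩ := hS p1
  obtain ⟨t2, m2, d2⟩ := hS p2
  obtain ⟨t3, m3, d3⟩ := hS p3
  obtain ⟨t4, m4, d4⟩ := hS p4
  have h3' := (((h3.move hL P.hb hb1' t1).symm.move hL P.hb hb1' t2).symm).movep P.hb d3
  have h4' := (((h4.move hL P.hb hb1' hK0 t1).symm.move hL P.hb hb1' hK0 t2).symm).movep P.hb d4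
  have key := lemCore P hW h0 hV hsup hI m1 m2 m3 m4 h3' h4'
  have n1 := dS_nonneg t1 p1
  have n2 := dS_nonneg t2 p2
  have n3 := mul_nonneg P.ha3.le (mul_nonneg (by linarith : 0 ≤ 1 - b) (dS_nonneg t3 p3))
  have n4 := mul_nonneg P.ha4.le (mul_nonneg (by linarith : 0 ≤ 1 - b) (dS_nonneg t4 p4))
  have hab : 0 ≤ a2 * b2 := mul_nonneg P.ha2.le (by linarith [P.hb2, P.he1])
  have q1 : a2 * b2 * dSum p1 p2 ≤ a2 * b2 * (dSum t1 p1 + dSum t1 t2 + dSum t2 p2) := by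
    apply mul_le_mul_of_nonneg_left _ hab
    have := dS_tri p1 t1 p2
    have := dS_tri t1 t2 p2
    have := dS_comm p1 t1
    linarith
  have z1 := mul_le_mul_of_nonneg_right P.n1 n1
  have z2 := mul_le_mul_of_nonneg_right P.n2 n2
  have z3 := mul_nonneg (mul_pos P.ha2 P.he).le n2
  have e1 : V t1 = V p1 - dSum t1 p1 := by linarith
  have e2 : V t2 = V p2 - dSum t2 p2 := by linarith
  rw [e1, e2] at key
  have hb2 := P.hb2
  subst hb2
  linarith

lemma lemInit (P : Par_s1 lam e b b2 C0 K a2 a3 a4 ρ c η θ θ4 A B) (O : X × Y) :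
    SInv b b2 K a2 a3 a4 (fun q => dSum O q) 0 := by
  intro p1 p2 p3 p4 g3 g4 h3 h4
  have hb1' : b ≤ 1 := by linarith [P.hb1, P.he]
  have hg : ∀ p g, C3 b (fun q => dSum O q) p1 p2 p g → -(2 * dSum O p1) ≤ g := by
    intro p g h
    have q1 := h.1
    have q2 := dS_tri p O p1
    rw [dS_comm p O] at q2
    have q3 := mul_le_mul_of_nonneg_left q2 P.hb
    have q4 := mul_le_mul_of_nonneg_right hb1' (dS_nonneg O p)
    have q5 := mul_le_mul_of_nonneg_right hb1' (dS_nonneg O p1)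
    linarith
  have k3 := mul_le_mul_of_nonneg_left (hg _ _ h3) P.ha3.le
  have k4 := mul_le_mul_of_nonneg_left (hg _ _ h4.1) P.ha4.le
  have q1 := dS_tri p1 O p2
  rw [dS_comm p1 O] at q1
  have q2 : b2 * dSum p1 p2 ≤ 1 * dSum p1 p2 :=
    mul_le_mul_of_nonneg_right (by linarith [P.hb2, P.he]) (dS_nonneg _ _)
  have q3 : a2 * (b2 * dSum p1 p2) ≤ a2 * (dSum O p1 + dSum O p2) :=
    mul_le_mul_of_nonneg_left (by linarith) P.ha2.le
  have q4 := mul_nonneg P.hinit (dS_nonneg O p1)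
  simp only
  linarith

lemma run_sup (hl0 : 0 ≤ lam) {O : X × Y} {σ : List (X × Y)} {s : ℕ → X × Y}
    (hr : gIsWFARun lam O σ s) (i : ℕ) (hi : i ≤ σ.length) (t : X × Y) :
    gWF O (σ.take i) (s i) ≤ gWF O (σ.take i) t + lam * dSum (s i) t := by
  cases i with
  | zero =>
    rw [hr.1]
    simp only [List.take_zero, gWF]
    have := mul_nonneg hl0 (dS_nonneg O t)
    have := dS_nonneg O t
    have := dS_self O
    linarith
  | succ i =>
    have h := hr.2 i hi t
    have := mul_le_mul_of_nonneg_left (dS_tri (s i) (s (i + 1)) t) hl0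
    linarith

lemma run_inv (P : Par_s1 lam e b b2 C0 K a2 a3 a4 ρ c η θ θ4 A B)
    {O : X × Y} {σ : List (X × Y)} {s : ℕ → X × Y}
    (hr : gIsWFARun lam O σ s) (i : ℕ) (hi : i ≤ σ.length) :
    Lp (gWF O (σ.take i)) ∧ (∃ r0, Sp (gWF O (σ.take i)) r0) ∧
    ∃ S : ℝ, SInv b b2 K a2 a3 a4 (gWF O (σ.take i)) (c * S) ∧
      lam * ∑ j ∈ Finset.range i, dSum (s j) (s (j + 1)) ≤ S - gWF O (σ.take i) (s i) := by
  induction i with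
  | zero =>
    have hf : gWF O (σ.take 0) = fun q => dSum O q := by
      funext q; simp [gWF]
    rw [hf]
    refine ⟨?_, ⟨O, ?_⟩, 0, ?_, ?_⟩
    · intro p q
      have := dS_tri O q p
      have := dS_comm p q
      simp only
      linarith
    · intro q
      refine ⟨O, Or.inl rfl, ?_⟩
      simp [dS_self]
    · rw [mul_zero]; exact lemInit P O
    · simp [hr.1, dS_self]
  | succ i ih =>
    obtain ⟨hL, ⟨r0, hS⟩, S, hI, hc⟩ := ih (by omega)
    have hlt : i < σ.length := by omega
    have hatt := gWF_att σ[i] (σ.take i) O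
    rw [← List.take_succ_eq_append_getElem hlt] at hatt
    have hst := lemStep P hL hS hatt (run_sup P.hlam0 hr i hlt.le) hI
    refine ⟨hatt.lp, ⟨_, hatt.sp hL⟩,
      S + (gWF O (σ.take (i + 1)) (s i) - gWF O (σ.take i) (s i)), ?_, ?_⟩
    · rw [mul_add]; exact hst
    · have h := hr.2 i hlt (s i)
      rw [dS_self, mul_zero] at h
      rw [Finset.sum_range_succ, mul_add]
      linarith

lemma run_bound (P : Par_s1 lam e b b2 C0 K a2 a3 a4 ρ c η θ θ4 A B)
    {O : X × Y} {σ : List (X × Y)} {s : ℕ → X × Y}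
    (hr : gIsWFARun lam O σ s) :
    lam * c * ∑ i ∈ Finset.range σ.length, dSum (s i) (s (i + 1)) ≤ gOpt O σ := by
  obtain ⟨hL, -, S, hI, hc⟩ := run_inv P hr σ.length le_rfl
  have hsup := run_sup P.hlam0 hr σ.length le_rfl
  rw [List.take_length] at hI hc hsup
  have h1 := gWF_nonneg σ O (s σ.length)
  have h2 := mul_le_mul_of_nonneg_left hc P.hc.le
  have h3 := mul_nonneg P.hc.le h1
  unfold gOpt
  refine le_csInf (Set.range_nonempty_iff_nonempty.2 ⟨O⟩) ?_
  rintro _ ⟨t, rfl⟩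
  have h4 := sup_C4 (by linarith [P.hlam, P.he] : lam ≤ b) (by linarith [P.hK8] : 0 ≤ K) hsup t t
  have h5 := hI _ _ _ _ _ _ h4.1 h4
  rw [dS_self] at h5
  linarith

lemma gOpt_nonneg (O : X × Y) (σ : List (X × Y)) : 0 ≤ gOpt O σ := by
  unfold gOpt
  apply Real.sInf_nonneg
  rintro _ ⟨t, rfl⟩
  exact gWF_nonneg σ O t

end wrap

lemma par_ex (lam : ℝ) (h0 : 0 < lam) (h1 : lam < 1) :
    ∃ e b b2 C0 K a2 a3 a4 ρ c η θ θ4 A B : ℝ,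
      Par_s1 lam e b b2 C0 K a2 a3 a4 ρ c η θ θ4 A B := by
  obtain ⟨e, he⟩ : ∃ e, e = (1 - lam) / 3 := ⟨_, rfl⟩
  have e0 : 0 < e := by linarith
  have e1 : e ≤ 1 / 3 := by linarith
  obtain ⟨f, hf⟩ : ∃ f, e * f = 1 := ⟨1 / e, by field_simp⟩
  have f3 : 3 ≤ f := by nlinarith
  have e2 : e ^ 2 ≤ 1 / 9 := by nlinarith
  have e20 : 0 < e ^ 2 := by positivity
  have e3 : e ^ 3 ≤ 1 / 9 * e := by nlinarith
  have e30 : 0 < e ^ 3 := by positivity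
  have e4 : e ^ 4 ≤ 1 / 9 * e ^ 2 := by nlinarith
  have e5 : e ^ 5 ≤ 1 / 9 * e ^ 3 := by nlinarith
  have e40 : 0 < e ^ 4 := by positivity
  have e50 : 0 < e ^ 5 := by positivity
  have e2' : e ^ 2 ≤ 1 / 3 * e := by nlinarith
  have k1 : f ^ 2 * e ^ 3 = e := by
    calc f ^ 2 * e ^ 3 = (e * f) ^ 2 * e := by ring
      _ = e := by rw [hf]; ring
  refine ⟨e, 1 - 2 * e, 1 - e, 16 * f, 64 * f ^ 2, 1 / 8, e / 128, e ^ 3 / 10000, e ^ 2 / 1000,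
    e ^ 5 / 10000000, e ^ 2 / 1000, e ^ 3 / 10000, e / 500, 16 * e ^ 4 / 10000000,
    16 * e ^ 2 / 10000, ?_⟩
  constructor
  case he => exact e0
  case he1 => exact e1
  case hb => linarith
  case hb1 => rfl
  case hlam => linarith
  case hlam0 => exact h0.le
  case hb2 => rfl
  case heC => linarith
  case hC0 => linarith
  case hKC =>
    have : e * (64 * f ^ 2) = 64 * f * (e * f) := by ring
    rw [this, hf]; linarith
  case hKC2 => nlinarith
  case hK8 => nlinarith
  case ha2 => norm_num
  case ha3 => positivity
  case ha4 => positivity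
  case hc => positivity
  case hρ => positivity
  case h34 => linarith
  case h2c => linarith
  case ha21 => norm_num
  case n1 =>
    have : (2 + 64 * f ^ 2) * (e ^ 3 / 10000) = 2 * e ^ 3 / 10000 + 64 * (f ^ 2 * e ^ 3) / 10000 := by
      ring
    rw [this, k1]; linarith
  case n2 =>
    have : (2 + 64 * f ^ 2) * (e ^ 3 / 10000) = 2 * e ^ 3 / 10000 + 64 * (f ^ 2 * e ^ 3) / 10000 := by
      ring
    rw [this, k1]; linarith
  case hcA => apply le_of_eq; ring
  case h4B => apply le_of_eq; ring
  case hA0 => positivity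
  case hB0 => positivity
  case hA => linarith
  case hB => linarith
  case hθa =>
    have q1 : 2 * (e ^ 2 / 1000) * (e ^ 3 / 10000) = 2 * e ^ 5 / 10000000 := by ring
    have q2 : 2 * e * (e / 128) * (e ^ 3 / 10000) = e ^ 5 / 640000 := by ring
    rw [q1, q2]; linarith
  case hθb =>
    have q1 : 2 * (e ^ 2 / 1000) * (e ^ 3 / 10000) = 2 * e ^ 5 / 10000000 := by ring
    have q2 : 1 / 8 * e / 2 * (e ^ 3 / 10000) = e ^ 4 / 160000 := by ring
    have q3 : e ^ 5 ≤ 1 / 3 * e ^ 4 := by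
      have : e ^ 5 = e * e ^ 4 := by ring
      rw [this]
      exact mul_le_mul_of_nonneg_right e1 e40.le
    rw [q1, q2]; linarith
  case hη0 => ring
  case hθ0 => positivity
  case hθ4 => nlinarith
  case hη => linarith
  case hθe => linarith
  case hθ2 => linarith
  case hθ42 => linarith
  case hfin =>
    have : 4 * (64 * f ^ 2 * (e ^ 3 / 10000)) = 256 * (f ^ 2 * e ^ 3) / 10000 := by ring
    rw [this, k1]; linarith
  case hinit => linarith
end helpers

/-- The generalized work function algorithm `WFA_λ` is constant competitive for the
generalized 2-server problem, for every `λ ∈ (0,1)`, with a constant depending only on `λ`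
(and in particular not on the metric spaces). -/
theorem wfa_constant_competitive_generalized_two_server (lam : ℝ) (h0 : 0 < lam)
    (h1 : lam < 1) :
    ∃ c : ℝ, 1 ≤ c ∧ ∀ (X Y : Type*) [MetricSpace X] [MetricSpace Y]
      (O : X × Y) (σ : List (X × Y)) (s : ℕ → X × Y),
      gIsWFARun lam O σ s →
      ∑ i ∈ Finset.range σ.length, dSum (s i) (s (i + 1)) ≤ c * gOpt O σ := by
  obtain ⟨e, b, b2, C0, K, a2, a3, a4, ρ, c, η, θ, θ4, A, B, P⟩ := par_ex lam h0 h1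
  refine ⟨max 1 (1 / (lam * c)), le_max_left _ _, ?_⟩
  intro X Y _ _ O σ s hr
  have hb := run_bound P hr
  have hlc : 0 < lam * c := mul_pos h0 P.hc
  have hn := gOpt_nonneg O σ
  calc _ ≤ 1 / (lam * c) * gOpt O σ := by
        rw [one_div_mul_eq_div, le_div_iff₀ hlc]
        linarith
    _ ≤ _ := mul_le_mul_of_nonneg_right (le_max_right _ _) hn
end
end
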